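/- Let 1 ≤ p, q ≤ ∞ with Hölder conjugates p*, q*, and let f ∈ L^{p*}(ℝ). Then there exists a (necessarily unique) F ∈ H^{p*,q*}(S*) whose trace along ℝ is F_0 = f if and only if there exists C > 0 such that |∫_ℝ f(x) · conj(h_0(x)) dx| ≤ C · ‖h_1‖_{L^q(ℝ)} for every h ∈ H^{p,q}(S), where h_0, h_1 are the boundary traces of h. Moreover, in this case the optimal constant is C = ‖F_{−1}‖_{L^{q*}(ℝ)}, where F_{−1} is the trace of F along ℝ − i. -/

import Mathlib

open MeasureTheory Complex Filter Set
open scoped Real ENNReal Topology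

noncomputable section

def Strip : Set ℂ := {z : ℂ | 0 < z.im ∧ z.im < 1}

def bLine (h : ℂ → ℂ) (y : ℝ) : ℝ → ℂ := fun x => h (x + y * Complex.I)

def hardyNorm (p q : ℝ≥0∞) (h : ℂ → ℂ) : ℝ≥0∞ :=
  ⨆ y ∈ Set.Ioo (0:ℝ) 1,
    ⨅ (f : ℝ → ℂ) (g : ℝ → ℂ) (_ : Measurable f) (_ : Measurable g)
      (_ : f + g = bLine h y),
      ENNReal.ofReal (1 - y)⁻¹ * eLpNorm f p volume +
        ENNReal.ofReal y⁻¹ * eLpNorm g q volume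

def MemHardy (p q : ℝ≥0∞) (h : ℂ → ℂ) : Prop :=
  DifferentiableOn ℂ h Strip ∧ hardyNorm p q h < ⊤

def IsTrace0 (h : ℂ → ℂ) (v : ℝ → ℂ) : Prop :=
  ∀ φ : SchwartzMap ℝ ℂ,
    Tendsto (fun y : ℝ => ∫ x : ℝ, h (x + y * Complex.I) * (starRingEnd ℂ) (φ x))
      (𝓝[>] (0:ℝ)) (𝓝 (∫ x : ℝ, v x * (starRingEnd ℂ) (φ x)))

def IsTrace1 (h : ℂ → ℂ) (w : ℝ → ℂ) : Prop :=
  ∀ φ : SchwartzMap ℝ ℂ,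
    Tendsto (fun y : ℝ => ∫ x : ℝ, h (x + y * Complex.I) * (starRingEnd ℂ) (φ x))
      (𝓝[<] (1:ℝ)) (𝓝 (∫ x : ℝ, w x * (starRingEnd ℂ) (φ x)))

def StripStar : Set ℂ := {z : ℂ | -1 < z.im ∧ z.im < 0}

def reflect (m : ℂ → ℂ) : ℂ → ℂ := fun z => (starRingEnd ℂ) (m ((starRingEnd ℂ) z))

/-- `m ∈ H^{p,q}(S*)` iff the reflected function `m*` belongs to `H^{p,q}(S)`. -/
def MemHardyStar (p q : ℝ≥0∞) (m : ℂ → ℂ) : Prop := MemHardy p q (reflect m)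

/-- trace of a function on `S*` along `ℝ` (limit `y ↑ 0`). -/
def IsTraceStar0 (m : ℂ → ℂ) (v : ℝ → ℂ) : Prop :=
  ∀ φ : SchwartzMap ℝ ℂ,
    Tendsto (fun y : ℝ => ∫ x : ℝ, m (x + y * Complex.I) * (starRingEnd ℂ) (φ x))
      (𝓝[<] (0:ℝ)) (𝓝 (∫ x : ℝ, v x * (starRingEnd ℂ) (φ x)))

/-- trace of a function on `S*` along `ℝ - i` (limit `y ↓ -1`). -/
def IsTraceStarNeg1 (m : ℂ → ℂ) (w : ℝ → ℂ) : Prop :=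
  ∀ φ : SchwartzMap ℝ ℂ,
    Tendsto (fun y : ℝ => ∫ x : ℝ, m (x + y * Complex.I) * (starRingEnd ℂ) (φ x))
      (𝓝[>] (-1:ℝ)) (𝓝 (∫ x : ℝ, w x * (starRingEnd ℂ) (φ x)))


/-! ### Hölder, convolution, translation -/

lemma one_le_conj {r s : ℝ≥0∞} (hc : r⁻¹ + s⁻¹ = 1) : 1 ≤ s := by
  have h : s⁻¹ ≤ 1 := by rw [← hc]; exact le_add_self
  exact ENNReal.inv_le_one.mp h

lemma holder_lintegral {r s : ℝ≥0∞} (hc : r⁻¹ + s⁻¹ = 1) {u v : ℝ → ℂ}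
    (hu : AEStronglyMeasurable u volume) (hv : AEStronglyMeasurable v volume) :
    ∫⁻ x, ‖u x * v x‖ₑ ≤ eLpNorm u r volume * eLpNorm v s volume := by
  have : ENNReal.HolderTriple r s 1 := ⟨by simpa using hc⟩
  have h := eLpNorm_smul_le_mul_eLpNorm (p := r) (q := s) (r := 1) (μ := volume) hv hu
  rw [eLpNorm_one_eq_lintegral_enorm] at h
  simpa using h

lemma holder_integrable {r s : ℝ≥0∞} (hc : r⁻¹ + s⁻¹ = 1) {u v : ℝ → ℂ}
    (hu : MemLp u r volume) (hv : MemLp v s volume) :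
    Integrable (fun x => u x * v x) volume := by
  refine ⟨hu.1.mul hv.1, ?_⟩
  exact (holder_lintegral hc hu.1 hv.1).trans_lt (ENNReal.mul_lt_top hu.2 hv.2)

lemma holder_norm {r s : ℝ≥0∞} (hc : r⁻¹ + s⁻¹ = 1) {u v : ℝ → ℂ}
    (hu : MemLp u r volume) (hv : MemLp v s volume) :
    ‖∫ x, u x * v x‖ ≤ (eLpNorm u r volume).toReal * (eLpNorm v s volume).toReal := by
  have h1 := enorm_integral_le_lintegral_enorm (μ := volume) (fun x => u x * v x)
  have h2 := h1.trans (holder_lintegral hc hu.1 hv.1)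
  have h3 := ENNReal.toReal_mono (ENNReal.mul_lt_top hu.2 hv.2).ne h2
  rwa [toReal_enorm, ENNReal.toReal_mul] at h3

/-- Scaled convolution. -/
def cv (κ u : ℝ → ℂ) (ε : ℝ) (x : ℝ) : ℂ := ∫ t, u (x - ε * t) * κ t

lemma qmp_affine (x : ℝ) {ε : ℝ} (hε : ε ≠ 0) :
    Measure.QuasiMeasurePreserving (fun t : ℝ => x - ε * t) volume volume := by
  have h1 : Measure.QuasiMeasurePreserving (fun t : ℝ => ε * t) volume volume := by
    refine ⟨by fun_prop, ?_⟩
    have := Real.map_volume_mul_left hε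
    rw [this]
    exact Measure.smul_absolutelyContinuous
  exact (Measure.measurePreserving_sub_left volume x).quasiMeasurePreserving.comp h1

lemma cv_congr {κ u u' : ℝ → ℂ} {ε : ℝ} (hε : ε ≠ 0) (h : u =ᵐ[volume] u') :
    cv κ u ε = cv κ u' ε := by
  funext x
  refine integral_congr_ae ?_
  filter_upwards [(qmp_affine x hε).ae h] with t ht
  simp [ht]

lemma qmp_prod {ε : ℝ} (ν : Measure ℝ) [SFinite ν] :
    Measure.QuasiMeasurePreserving (fun z : ℝ × ℝ => z.1 - ε * z.2) (volume.prod ν) volume := by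
  refine ⟨by fun_prop, ?_⟩
  refine Measure.AbsolutelyContinuous.mk fun s hs h0 => ?_
  rw [Measure.map_apply (by fun_prop) hs, Measure.prod_apply_symm ((by fun_prop : Measurable (fun z : ℝ × ℝ => z.1 - ε * z.2)) hs)]
  rw [lintegral_eq_zero_iff']
  · refine Eventually.of_forall fun t => ?_
    exact (measurePreserving_sub_right volume (ε * t)).quasiMeasurePreserving.preimage_null h0
  · exact (measurable_measure_prodMk_right ((by fun_prop : Measurable (fun z : ℝ × ℝ => z.1 - ε * z.2)) hs)).aemeasurable

lemma cv_aesm_prod {κ u : ℝ → ℂ} {ε : ℝ} (hκ : AEStronglyMeasurable κ volume)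
    (hu : AEStronglyMeasurable u volume) :
    AEStronglyMeasurable (fun z : ℝ × ℝ => u (z.1 - ε * z.2) * κ z.2) (volume.prod volume) :=
  (hu.comp_quasiMeasurePreserving (qmp_prod volume)).mul hκ.comp_snd

lemma cv_aesm {κ u : ℝ → ℂ} {ε : ℝ} (hκ : AEStronglyMeasurable κ volume)
    (hu : AEStronglyMeasurable u volume) :
    AEStronglyMeasurable (cv κ u ε) volume :=
  (cv_aesm_prod hκ hu).integral_prod_right'

lemma eLpNorm_shift (u : ℝ → ℂ) (r : ℝ≥0∞) (hu : AEStronglyMeasurable u volume) (s : ℝ) :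
    eLpNorm (fun x => u (x - s)) r volume = eLpNorm u r volume :=
  eLpNorm_comp_measurePreserving hu (measurePreserving_sub_right volume s)

lemma memLp_shift {u : ℝ → ℂ} {r : ℝ≥0∞} (hu : MemLp u r volume) (s : ℝ) :
    MemLp (fun x => u (x - s)) r volume :=
  hu.comp_measurePreserving (measurePreserving_sub_right volume s)

/-- Young's inequality `L¹ * Lʳ ⊆ Lʳ`. -/
lemma young {κ u : ℝ → ℂ} {ε : ℝ} (hε : ε ≠ 0) {r : ℝ≥0∞} (hr : 1 ≤ r) (hκ : Integrable κ volume)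
    (hu : AEStronglyMeasurable u volume) :
    eLpNorm (cv κ u ε) r volume ≤ (∫⁻ t, ‖κ t‖ₑ) * eLpNorm u r volume := by
  set c : ℝ≥0∞ := ∫⁻ t, ‖κ t‖ₑ with hc
  have hcf : c ≠ ∞ := hκ.2.ne
  have hbd : ∀ x, ‖cv κ u ε x‖ₑ ≤ ∫⁻ t, ‖u (x - ε * t)‖ₑ * ‖κ t‖ₑ := by
    intro x
    refine (enorm_integral_le_lintegral_enorm _).trans (le_of_eq ?_)
    simp
  rcases eq_or_ne r ∞ with rfl | hrt
  · simp only [eLpNorm_exponent_top]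
    refine essSup_le_of_ae_le _ (Eventually.of_forall fun x => ?_)
    refine (hbd x).trans ?_
    have : ∀ᵐ t, ‖u (x - ε * t)‖ₑ * ‖κ t‖ₑ ≤ eLpNormEssSup u volume * ‖κ t‖ₑ := by
      filter_upwards [(qmp_affine x hε).ae (ae_le_eLpNormEssSup (f := u) (μ := volume))] with t ht
      gcongr
    refine (lintegral_mono_ae this).trans ?_
    rw [lintegral_const_mul'' _ hκ.1.enorm, mul_comm]
  · have hr0 : r ≠ 0 := (one_pos.trans_le hr).ne'
    have hr1 : 1 ≤ r.toReal := by
      have := ENNReal.toReal_mono hrt hr; simpa using this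
    have hrp : 0 < r.toReal := by linarith
    set μ : Measure ℝ := volume.withDensity (fun t => ‖κ t‖ₑ) with hμ
    have hμu : μ univ = c := by simp [hμ, hc]
    have : IsFiniteMeasure μ := ⟨by rw [hμu]; exact hcf.lt_top⟩
    have hac : μ ≪ volume := withDensity_absolutelyContinuous _ _
    have h1 : ∀ x, ∫⁻ t, ‖u (x - ε * t)‖ₑ * ‖κ t‖ₑ = eLpNorm (fun t => u (x - ε * t)) 1 μ := by
      intro x
      rw [eLpNorm_one_eq_lintegral_enorm, hμ, lintegral_withDensity_eq_lintegral_mul₀' hκ.1.enorm]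
      · simp [mul_comm]
      · exact ((hu.comp_quasiMeasurePreserving (qmp_affine x hε)).mono_ac hac).enorm
    have h2 : ∀ x, ‖cv κ u ε x‖ₑ ^ r.toReal ≤
        (∫⁻ t, ‖u (x - ε * t)‖ₑ ^ r.toReal ∂μ) * c ^ (r.toReal - 1) := by
      intro x
      have h3 := eLpNorm_le_eLpNorm_mul_rpow_measure_univ (μ := μ) hr
        ((hu.comp_quasiMeasurePreserving (qmp_affine x hε)).mono_ac hac)
      have h4 := (hbd x).trans ((h1 x).le.trans h3)
      rw [hμu] at h4
      have h5 := ENNReal.rpow_le_rpow h4 hrp.le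
      refine h5.trans (le_of_eq ?_)
      rw [ENNReal.mul_rpow_of_nonneg _ _ hrp.le, eLpNorm_eq_lintegral_rpow_enorm_toReal hr0 hrt,
        ← ENNReal.rpow_mul, ← ENNReal.rpow_mul]
      congr 2
      · simp [hrp.ne']
      · simp; field_simp
    have h6 : ∫⁻ x, ∫⁻ t, ‖u (x - ε * t)‖ₑ ^ r.toReal ∂μ = c * ∫⁻ x, ‖u x‖ₑ ^ r.toReal := by
      rw [lintegral_lintegral_swap]
      · have : ∀ t, ∫⁻ x, ‖u (x - ε * t)‖ₑ ^ r.toReal = ∫⁻ x, ‖u x‖ₑ ^ r.toReal := fun t =>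
          lintegral_sub_right_eq_self (fun x => ‖u x‖ₑ ^ r.toReal) (ε * t)
        simp [this, hμu, mul_comm]
      · exact ((hu.comp_quasiMeasurePreserving (qmp_prod μ)).enorm).pow_const _
    rw [eLpNorm_eq_lintegral_rpow_enorm_toReal hr0 hrt, eLpNorm_eq_lintegral_rpow_enorm_toReal hr0 hrt]
    have h7 : ∫⁻ x, ‖cv κ u ε x‖ₑ ^ r.toReal ≤ c ^ r.toReal * ∫⁻ x, ‖u x‖ₑ ^ r.toReal := by
      refine (lintegral_mono h2).trans ?_
      rw [lintegral_mul_const' _ _ (ENNReal.rpow_ne_top_of_nonneg (by linarith) hcf), h6]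
      refine le_of_eq ?_
      have : c ^ r.toReal = c * c ^ (r.toReal - 1) := by
        conv_rhs => rw [← ENNReal.rpow_one c, ← ENNReal.rpow_mul, one_mul]
        rw [← ENNReal.rpow_add_of_nonneg _ _ (by norm_num) (by linarith)]
        congr 1; ring
      rw [this]; ring
    refine (ENNReal.rpow_le_rpow h7 (by positivity : 0 ≤ 1 / r.toReal)).trans (le_of_eq ?_)
    rw [ENNReal.mul_rpow_of_nonneg _ _ (by positivity), ← ENNReal.rpow_mul]
    simp [hrp.ne']

lemma cv_memLp {κ u : ℝ → ℂ} {ε : ℝ} (hε : ε ≠ 0) {r : ℝ≥0∞} (hr : 1 ≤ r) (hκ : Integrable κ volume)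
    (hu : MemLp u r volume) : MemLp (cv κ u ε) r volume :=
  ⟨cv_aesm hκ.1 hu.1, (young hε hr hκ hu.1).trans_lt (ENNReal.mul_lt_top hκ.2 hu.2)⟩

lemma tendsto_shift {u : ℝ → ℂ} {r : ℝ≥0∞} (hr : 1 ≤ r) (hrt : r ≠ ∞) (hu : MemLp u r volume) :
    Tendsto (fun s : ℝ => eLpNorm (fun x => u (x - s) - u x) r volume) (𝓝 0) (𝓝 0) := by
  have : Fact (1 ≤ r) := ⟨hr⟩
  let g : C(ℝ, C(ℝ, ℝ)) := (ContinuousMap.mk (fun a : ℝ × ℝ => a.2 - a.1) (by fun_prop)).curry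
  have hgm : ∀ s, MeasurePreserving (g s) (volume : Measure ℝ) volume :=
    fun s => measurePreserving_sub_right volume s
  have h := (Filter.Tendsto.compMeasurePreservingLp (tendsto_const_nhds (x := hu.toLp u) (f := 𝓝 (0:ℝ)))
    (g.continuous.tendsto 0) hgm (hgm 0) hrt)
  have h2 := (Lp.tendsto_Lp_iff_tendsto_eLpNorm' _ _).mp h
  refine h2.congr fun s => ?_
  refine eLpNorm_congr_ae ?_
  have e1 := Lp.coeFn_compMeasurePreserving (hu.toLp u) (hgm s)
  have e0 := Lp.coeFn_compMeasurePreserving (hu.toLp u) (hgm 0)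
  have e2 := (hgm s).quasiMeasurePreserving.ae hu.coeFn_toLp
  have e3 := (hgm 0).quasiMeasurePreserving.ae hu.coeFn_toLp
  filter_upwards [e1, e0, e2, e3] with x h1 h0 h2 h3
  simp only [Pi.sub_apply, h1, h0, Function.comp, h2, h3]
  simp [g]

lemma tendsto_corr {r s : ℝ≥0∞} (hr : 1 ≤ r) (hs : 1 ≤ s) (hc : r⁻¹ + s⁻¹ = 1) {u v : ℝ → ℂ}
    (hu : MemLp u r volume) (hv : MemLp v s volume) :
    Tendsto (fun a : ℝ => ∫ x, u (x - a) * v x) (𝓝 0) (𝓝 (∫ x, u x * v x)) := by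
  have key : ∀ {r s : ℝ≥0∞} (_ : 1 ≤ r) (_ : r ≠ ∞) (_ : r⁻¹ + s⁻¹ = 1) {u v : ℝ → ℂ}
    (_ : MemLp u r volume) (_ : MemLp v s volume),
    Tendsto (fun a : ℝ => ∫ x, u (x - a) * v x) (𝓝 0) (𝓝 (∫ x, u x * v x)) := by
    intro r s hr hrt hc u v hu hv
    rw [tendsto_iff_norm_sub_tendsto_zero]
    have h1 : Tendsto (fun a : ℝ => (eLpNorm (fun x => u (x - a) - u x) r volume).toReal *
        (eLpNorm v s volume).toReal) (𝓝 0) (𝓝 0) := by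
      have := (ENNReal.tendsto_toReal ENNReal.zero_ne_top).comp (tendsto_shift hr hrt hu)
      simpa using this.mul_const ((eLpNorm v s volume).toReal)
    refine squeeze_zero (fun _ => norm_nonneg _) (fun a => ?_) h1
    rw [← integral_sub (holder_integrable hc (memLp_shift hu a) hv) (holder_integrable hc hu hv)]
    refine le_trans (le_of_eq ?_) (holder_norm hc ((memLp_shift hu a).sub hu) hv)
    congr 1
    refine integral_congr_ae (Eventually.of_forall fun x => ?_)
    simp; ring
  by_cases hrt : r = ∞
  · have hst : s ≠ ∞ := by
      rintro rfl; simp [hrt] at hc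
    have h := key hs hst (by rwa [add_comm]) hv hu
    have h2 := h.comp (by simpa using (continuous_neg (G := ℝ)).tendsto 0 : Tendsto (fun a : ℝ => -a) (𝓝 0) (𝓝 0))
    simp only [mul_comm (v _)] at h2
    refine h2.congr fun a => ?_
    have := integral_sub_right_eq_self (μ := (volume : Measure ℝ)) (fun x => u x * v (x + a)) a
    simp only [Function.comp, sub_neg_eq_add]
    rw [← this]
    simp
  · exact key hr hrt hc hu hv

lemma corr_fubini {r s : ℝ≥0∞} (hc : r⁻¹ + s⁻¹ = 1) {κ u v : ℝ → ℂ} {ε : ℝ}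
    (hκ : Integrable κ volume) (hu : MemLp u r volume) (hv : MemLp v s volume) :
    Integrable (fun z : ℝ × ℝ => u (z.1 - ε * z.2) * κ z.2 * v z.1) (volume.prod volume) := by
  have hm : AEStronglyMeasurable (fun z : ℝ × ℝ => u (z.1 - ε * z.2) * κ z.2 * v z.1) (volume.prod volume) :=
    (cv_aesm_prod hκ.1 hu.1).mul hv.1.comp_fst
  rw [integrable_prod_iff' hm]
  constructor
  · refine Eventually.of_forall fun t => ?_
    have := (holder_integrable hc (memLp_shift hu (ε * t)) hv).mul_const (κ t)
    refine this.congr (Eventually.of_forall fun x => ?_)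
    simp; ring
  · have hb : Integrable (fun t => (eLpNorm u r volume).toReal * (eLpNorm v s volume).toReal * ‖κ t‖) volume :=
      hκ.norm.const_mul _
    refine hb.mono' hm.norm.prod_swap.integral_prod_right' ?_
    refine Eventually.of_forall fun t => ?_
    have h1 : ∫ x, ‖u (x - ε * t) * κ t * v x‖ = (∫ x, ‖u (x - ε * t) * v x‖) * ‖κ t‖ := by
      rw [← integral_mul_const]
      congr 1; funext x; simp; ring
    rw [Real.norm_of_nonneg (integral_nonneg fun _ => norm_nonneg _), h1]
    gcongr
    have hsu := memLp_shift hu (ε * t)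
    rw [integral_norm_eq_lintegral_enorm (f := fun x => u (x - ε * t) * v x) (hsu.1.mul hv.1)]
    have h2 := holder_lintegral hc hsu.1 hv.1
    rw [eLpNorm_shift u r hu.1] at h2
    have h3 := ENNReal.toReal_mono (ENNReal.mul_lt_top hu.2 hv.2).ne h2
    rwa [ENNReal.toReal_mul] at h3

/-- Approximate identity, tested weakly. -/
lemma tendsto_moll {r s : ℝ≥0∞} (hr : 1 ≤ r) (hs : 1 ≤ s) (hc : r⁻¹ + s⁻¹ = 1) {κ u v : ℝ → ℂ}
    (hκ : Integrable κ volume) (hkerB : ∫ t, κ t = 1)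
    (hu : MemLp u r volume) (hv : MemLp v s volume) :
    Tendsto (fun ε : ℝ => ∫ x, cv κ u ε x * v x) (𝓝 0) (𝓝 (∫ x, u x * v x)) := by
  have h1 : ∀ ε : ℝ, ∫ x, cv κ u ε x * v x = ∫ t, (∫ x, u (x - ε * t) * v x) * κ t := by
    intro ε
    have := integral_integral_swap (μ := (volume : Measure ℝ)) (ν := (volume : Measure ℝ))
      (f := fun x t => u (x - ε * t) * κ t * v x) (corr_fubini hc hκ hu hv)
    simp only [cv, ← integral_mul_const]
    rw [this]
    congr 1; funext t; congr 1; funext x; ring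
  simp only [h1]
  have h2 : ∫ x, u x * v x = ∫ t, (∫ x, u x * v x) * κ t := by
    rw [integral_const_mul, hkerB, mul_one]
  rw [h2]
  refine tendsto_integral_filter_of_dominated_convergence
    (fun t => (eLpNorm u r volume).toReal * (eLpNorm v s volume).toReal * ‖κ t‖) ?_ ?_ (hκ.norm.const_mul _) ?_
  · refine Eventually.of_forall fun ε => ?_
    have := (corr_fubini (ε := ε) hc hκ hu hv).1.prod_swap.integral_prod_right'
    refine this.congr (Eventually.of_forall fun t => ?_)
    simp only [← integral_mul_const]
    congr 1; funext x; simp; ring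
  · refine Eventually.of_forall fun ε => Eventually.of_forall fun t => ?_
    rw [norm_mul]
    gcongr
    have := holder_norm hc (memLp_shift hu (ε * t)) hv
    rwa [eLpNorm_shift u r hu.1] at this
  · refine Eventually.of_forall fun t => ?_
    refine Tendsto.mul_const _ ?_
    have h3 : Tendsto (fun ε : ℝ => ε * t) (𝓝 0) (𝓝 0) := by
      have : Continuous (fun ε : ℝ => ε * t) := by fun_prop
      simpa using this.tendsto 0
    exact (tendsto_corr hr hs hc hu hv).comp h3

/-! ### Duality against bounded, compactly supported test functions -/

/-- Bounded measurable functions with bounded support. -/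
def IsTest (φ : ℝ → ℂ) : Prop :=
  Measurable φ ∧ ∃ B R : ℝ, (∀ x, ‖φ x‖ ≤ B) ∧ ∀ x, R < |x| → φ x = 0

lemma IsTest.memLp {φ : ℝ → ℂ} (h : IsTest φ) (r : ℝ≥0∞) : MemLp φ r volume := by
  obtain ⟨hm, B, R, hB, hR⟩ := h
  have h1 : MemLp (fun _ : ℝ => B) r (volume.restrict (Icc (-R) R)) := by
    exact memLp_const B
  have h2 : MemLp ((Icc (-R) R).indicator (fun _ : ℝ => B)) r volume :=
    (memLp_indicator_iff_restrict measurableSet_Icc).mpr h1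
  refine h2.of_le hm.aestronglyMeasurable (Eventually.of_forall fun x => ?_)
  by_cases hx : x ∈ Icc (-R) R
  · rw [indicator_of_mem hx]; exact (hB x).trans (le_abs_self B)
  · rw [hR x ?_]
    · simp
    · by_contra hcon
      push Not at hcon
      exact hx (abs_le.mp hcon)

/-- The conjugate phase. -/
def phs (z : ℂ) : ℂ := (starRingEnd ℂ) z / (‖z‖ : ℂ)

lemma phs_mul (z : ℂ) : z * phs z = (‖z‖ : ℂ) := by
  unfold phs
  by_cases h : z = 0
  · simp [h]
  · have hn : (‖z‖ : ℂ) ≠ 0 := by simpa using h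
    rw [← mul_div_assoc, Complex.mul_conj, Complex.normSq_eq_norm_sq]
    field_simp
    push_cast; ring

lemma norm_phs_le (z : ℂ) : ‖phs z‖ ≤ 1 := by
  unfold phs
  by_cases h : z = 0
  · simp [h]
  · have hn : ‖z‖ ≠ 0 := by simpa using h
    simp [hn]

lemma norm_phs {z : ℂ} (h : z ≠ 0) : ‖phs z‖ = 1 := by
  unfold phs
  have hn : ‖z‖ ≠ 0 := by simpa using h
  simp [hn]

lemma measurable_phs : Measurable phs := by
  unfold phs
  have h1 : Measurable fun z : ℂ => (starRingEnd ℂ) z := Complex.continuous_conj.measurable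
  have h2 : Measurable fun z : ℂ => (‖z‖ : ℂ) := (Complex.continuous_ofReal.comp continuous_norm).measurable
  exact h1.div h2

lemma dual_bound_test {r s : ℝ≥0∞} (hc : r⁻¹ + s⁻¹ = 1) {w : ℝ → ℂ} (hw : IsTest w) {C : ℝ}
    (hC : 0 ≤ C)
    (H : ∀ φ, IsTest φ → ‖∫ x, w x * φ x‖ ≤ C * (eLpNorm φ r volume).toReal) :
    eLpNorm w s volume ≤ ENNReal.ofReal C := by
  have hs1 : 1 ≤ s := one_le_conj hc
  have hr1 : 1 ≤ r := one_le_conj (by rwa [add_comm])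
  obtain ⟨hm, B, R, hB, hR⟩ := hw
  have hB0 : 0 ≤ B := (norm_nonneg _).trans (hB 0)
  by_cases hs : s = ∞
  · -- L^∞
    subst hs
    have hr : r = 1 := by simpa using hc
    subst hr
    rw [eLpNorm_exponent_top]
    refine essSup_le_of_ae_le _ ?_
    have key : ∀ n : ℕ, volume {x | C + 1 / (n + 1) ≤ ‖w x‖} = 0 := by
      intro n
      set E := {x | C + 1 / ((n : ℝ) + 1) ≤ ‖w x‖} with hE
      have hEm : MeasurableSet E := measurableSet_le measurable_const hm.norm
      have hd : (0 : ℝ) < 1 / ((n : ℝ) + 1) := by positivity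
      have hEsub : E ⊆ Icc (-R) R := by
        intro x hx
        by_contra hcon
        have : R < |x| := by
          by_contra h'
          push Not at h'
          exact hcon (abs_le.mp h')
        have h0 := hR x this
        simp only [hE, mem_ofPred_eq, h0, norm_zero] at hx
        linarith
      have hEf : volume E ≠ ∞ := ((measure_mono hEsub).trans_lt (by simp)).ne
      have hφ : IsTest (E.indicator fun x => phs (w x)) := by
        refine ⟨(measurable_phs.comp hm).indicator hEm, 1, R, fun x => ?_, fun x hx => ?_⟩
        · by_cases hx : x ∈ E
          · rw [indicator_of_mem hx]; exact norm_phs_le _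
          · rw [indicator_of_notMem hx]; simp
        · have : w x = 0 := hR x hx
          by_cases hx : x ∈ E
          · rw [indicator_of_mem hx, this]; simp [phs]
          · rw [indicator_of_notMem hx]
      have h1 := H _ hφ
      have h2 : ∫ x, w x * E.indicator (fun x => phs (w x)) x = ((∫ x in E, ‖w x‖ : ℝ) : ℂ) := by
        rw [← integral_indicator hEm, ← integral_complex_ofReal]
        congr 1; funext x
        by_cases hx : x ∈ E
        · simp only [indicator_of_mem hx, phs_mul]
        · simp only [indicator_of_notMem hx]; simp
      have h3 : (eLpNorm (E.indicator fun x => phs (w x)) 1 volume).toReal ≤ (volume E).toReal := by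
        refine ENNReal.toReal_mono hEf ?_
        rw [eLpNorm_one_eq_lintegral_enorm, ← lintegral_indicator_one hEm]
        refine lintegral_mono fun x => ?_
        by_cases hx : x ∈ E
        · simp only [indicator_of_mem hx]
          rw [← ofReal_norm]; exact (ENNReal.ofReal_le_ofReal (norm_phs_le (w x))).trans (by simp)
        · simp only [indicator_of_notMem hx]; simp
      have h_intg : IntegrableOn (fun x => ‖w x‖) E volume := by
        refine Integrable.norm ?_
        have : Integrable w volume := by
          have := IsTest.memLp ⟨hm, B, R, hB, hR⟩ 1
          exact memLp_one_iff_integrable.mp this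
        exact this.integrableOn
      have h4 : (C + 1 / ((n : ℝ) + 1)) * (volume E).toReal ≤ ∫ x in E, ‖w x‖ := by
        have := setIntegral_mono_on (μ := volume) (s := E) (f := fun _ => C + 1 / ((n : ℝ) + 1))
          (integrableOn_const hEf) h_intg hEm (fun x hx => hx)
        rw [setIntegral_const] at this
        simpa [Measure.real, mul_comm] using this
      rw [h2, Complex.norm_real, Real.norm_of_nonneg (integral_nonneg fun _ => norm_nonneg _)] at h1
      have h5 : (C + 1 / ((n : ℝ) + 1)) * (volume E).toReal ≤ C * (volume E).toReal :=
        h4.trans (h1.trans (mul_le_mul_of_nonneg_left h3 hC))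
      have h6 : (volume E).toReal = 0 := by
        have : 0 ≤ (volume E).toReal := ENNReal.toReal_nonneg
        nlinarith
      exact ((ENNReal.toReal_eq_zero_iff _).mp h6).resolve_right hEf
    have hae : ∀ᵐ x, ∀ n : ℕ, ¬ (C + 1 / ((n : ℝ) + 1) ≤ ‖w x‖) := by
      rw [ae_all_iff]
      intro n
      rw [ae_iff]; simpa using key n
    filter_upwards [hae] with x hx
    rw [← ofReal_norm]
    refine ENNReal.ofReal_le_ofReal ?_
    by_contra hcon
    push Not at hcon
    obtain ⟨n, hn⟩ := exists_nat_one_div_lt (sub_pos.mpr hcon)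
    exact hx n (by linarith)
  · have hsr : 1 ≤ s.toReal := by
      have := ENNReal.toReal_mono hs hs1; simpa using this
    have hs0 : s ≠ 0 := (one_pos.trans_le hs1).ne'
    have hφ : IsTest (fun x => phs (w x) * ((‖w x‖ ^ (s.toReal - 1) : ℝ) : ℂ)) := by
      refine ⟨(measurable_phs.comp hm).mul
        (Complex.measurable_ofReal.comp (hm.norm.pow_const _)), B ^ (s.toReal - 1), R, fun x => ?_, fun x hx => ?_⟩
      · rw [norm_mul, Complex.norm_real, Real.norm_of_nonneg (by positivity)]
        calc _ ≤ 1 * B ^ (s.toReal - 1) := by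
              gcongr
              · exact norm_phs_le _
              · exact hB x
          _ = _ := one_mul _
      · simp [hR x hx, phs]
    have h1 := H _ hφ
    have h2 : ∫ x, w x * (phs (w x) * ((‖w x‖ ^ (s.toReal - 1) : ℝ) : ℂ)) =
        ((∫ x, ‖w x‖ ^ s.toReal : ℝ) : ℂ) := by
      rw [← integral_complex_ofReal]
      congr 1; funext x
      rw [← mul_assoc, phs_mul, ← Complex.ofReal_mul]
      congr 1
      by_cases h0 : ‖w x‖ = 0
      · rw [h0, Real.zero_rpow (by linarith : s.toReal ≠ 0), zero_mul]
      · conv_lhs => rw [← Real.rpow_one ‖w x‖, ← Real.rpow_mul (norm_nonneg _), one_mul]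
        rw [← Real.rpow_add (lt_of_le_of_ne (norm_nonneg _) (Ne.symm h0))]
        congr 1; ring
    have hwm : MemLp w s volume := IsTest.memLp ⟨hm, B, R, hB, hR⟩ s
    set X : ℝ := ∫ x, ‖w x‖ ^ s.toReal with hX
    have hX0 : 0 ≤ X := integral_nonneg fun x => by positivity
    have hnorm : eLpNorm w s volume = ENNReal.ofReal (X ^ (s.toReal)⁻¹) :=
      hwm.eLpNorm_eq_integral_rpow_norm hs0 hs
    rw [h2, Complex.norm_real, Real.norm_of_nonneg hX0] at h1
    rw [hnorm]
    refine ENNReal.ofReal_le_ofReal ?_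
    rcases hX0.eq_or_lt with h0 | hXpos
    · rw [← h0, Real.zero_rpow (by positivity)]; exact hC
    have hφn : (eLpNorm (fun x => phs (w x) * ((‖w x‖ ^ (s.toReal - 1) : ℝ) : ℂ)) r volume).toReal
        ≤ X ^ (1 - (s.toReal)⁻¹) := by
      by_cases hr : r = ∞
      · subst hr
        have hs' : s = 1 := by simpa using hc
        subst hs'
        simp only [ENNReal.toReal_one, sub_self, inv_one, Real.rpow_zero]
        have : eLpNorm (fun x => phs (w x) * ((1 : ℝ) : ℂ)) ∞ volume ≤ ENNReal.ofReal 1 := by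
          rw [eLpNorm_exponent_top]
          refine eLpNormEssSup_le_of_ae_bound (Eventually.of_forall fun x => ?_)
          simpa using norm_phs_le (w x)
        simpa using ENNReal.toReal_mono (by simp) this
      · have hr0 : r ≠ 0 := (one_pos.trans_le hr1).ne'
        have hcr : (r.toReal)⁻¹ + (s.toReal)⁻¹ = 1 := by
          have := congrArg ENNReal.toReal hc
          rw [ENNReal.toReal_add (by simpa using hr0) (by simpa using hs0), ENNReal.toReal_inv, ENNReal.toReal_inv] at this
          simpa using this
        have hrr : 0 < r.toReal := ENNReal.toReal_pos hr0 hr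
        rw [(hφ.memLp r).eLpNorm_eq_integral_rpow_norm hr0 hr, ENNReal.toReal_ofReal (by positivity)]
        have : ∀ x, ‖phs (w x) * ((‖w x‖ ^ (s.toReal - 1) : ℝ) : ℂ)‖ ^ r.toReal = ‖w x‖ ^ s.toReal := by
          intro x
          by_cases h0 : w x = 0
          · simp only [h0, phs]
            simp [hrr.ne', (by linarith : s.toReal ≠ 0)]
          · rw [norm_mul, norm_phs h0, one_mul, Complex.norm_real, Real.norm_of_nonneg (by positivity),
              ← Real.rpow_mul (norm_nonneg _)]
            congr 1
            field_simp at hcr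
            linarith
        simp only [this]
        rw [← hX]
        have e : (r.toReal)⁻¹ = 1 - (s.toReal)⁻¹ := by linarith
        rw [e]
    have h3 : X ≤ C * X ^ (1 - (s.toReal)⁻¹) := h1.trans (mul_le_mul_of_nonneg_left hφn hC)
    have h4 : X ^ (s.toReal)⁻¹ * X ^ (1 - (s.toReal)⁻¹) = X := by
      rw [← Real.rpow_add hXpos]; simp
    have h5 : 0 < X ^ (1 - (s.toReal)⁻¹) := by positivity
    exact le_of_mul_le_mul_right (h4.le.trans h3) h5

lemma dual_bound {r s : ℝ≥0∞} (hc : r⁻¹ + s⁻¹ = 1) {w : ℝ → ℂ} (hw : AEStronglyMeasurable w volume) {C : ℝ}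
    (hC : 0 ≤ C)
    (H : ∀ φ, IsTest φ → ‖∫ x, w x * φ x‖ ≤ C * (eLpNorm φ r volume).toReal) :
    eLpNorm w s volume ≤ ENNReal.ofReal C := by
  obtain ⟨w', hw'm, hww'⟩ := hw
  rw [eLpNorm_congr_ae hww']
  have H' : ∀ φ, IsTest φ → ‖∫ x, w' x * φ x‖ ≤ C * (eLpNorm φ r volume).toReal := by
    intro φ hφ
    refine le_trans (le_of_eq ?_) (H φ hφ)
    congr 1
    refine integral_congr_ae ?_
    filter_upwards [hww'] with x hx
    rw [hx]
  have hm := hw'm.measurable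
  let E : ℕ → Set ℝ := fun n => {x | ‖w' x‖ ≤ n ∧ |x| ≤ n}
  have hEm : ∀ n, MeasurableSet (E n) := fun n =>
    (measurableSet_le hm.norm measurable_const).inter (measurableSet_le (continuous_abs.measurable) measurable_const)
  have htest : ∀ n, IsTest ((E n).indicator w') := by
    intro n
    refine ⟨hm.indicator (hEm n), n, n, fun x => ?_, fun x hx => ?_⟩
    · by_cases h : x ∈ E n
      · rw [indicator_of_mem h]; exact h.1
      · rw [indicator_of_notMem h]; simp
    · rw [indicator_of_notMem]
      intro h
      exact absurd h.2 (not_le.mpr hx)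
  have hb : ∀ n, eLpNorm ((E n).indicator w') s volume ≤ ENNReal.ofReal C := by
    intro n
    refine dual_bound_test hc (htest n) hC fun φ hφ => ?_
    have hφ' : IsTest ((E n).indicator φ) := by
      obtain ⟨hφm, B, R, hB, hR⟩ := hφ
      refine ⟨hφm.indicator (hEm n), B, R, fun x => ?_, fun x hx => ?_⟩
      · exact (norm_indicator_le_norm_self _ _).trans (hB x)
      · simp [indicator, hR x hx]
    have h1 := H' _ hφ'
    have h2 : ∫ x, (E n).indicator w' x * φ x = ∫ x, w' x * (E n).indicator φ x := by
      congr 1; funext x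
      by_cases h : x ∈ E n
      · simp [h]
      · simp [h]
    rw [h2]
    refine h1.trans ?_
    refine mul_le_mul_of_nonneg_left (ENNReal.toReal_mono (hφ.memLp r).2.ne ?_) hC
    exact eLpNorm_mono fun x => norm_indicator_le_norm_self φ x
  have hlim : ∀ᵐ x : ℝ, Tendsto (fun n => (E n).indicator w' x) atTop (𝓝 (w' x)) := by
    refine Eventually.of_forall fun x => ?_
    refine tendsto_const_nhds.congr' ?_
    obtain ⟨N, hN⟩ := exists_nat_ge (max ‖w' x‖ |x|)
    filter_upwards [eventually_ge_atTop N] with n hn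
    have : x ∈ E n := by
      have h1 : (N : ℝ) ≤ n := by exact_mod_cast hn
      exact ⟨(le_max_left _ _).trans (hN.trans h1), (le_max_right _ _).trans (hN.trans h1)⟩
    rw [indicator_of_mem this]
  refine (Lp.eLpNorm_lim_le_liminf_eLpNorm (fun n => (htest n).1.aestronglyMeasurable) w' hlim).trans ?_
  refine (liminf_le_liminf (Eventually.of_forall hb)).trans ?_
  simp

/-! ### Nice functions on the closed strip and contour shifting -/

/-- The closed strip. -/
def CStrip : Set ℂ := {z : ℂ | 0 ≤ z.im ∧ z.im ≤ 1}

structure Nice (G : ℂ → ℂ) : Prop where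
  cont : ContinuousOn G CStrip
  diff : DifferentiableOn ℂ G Strip
  bdd : ∃ B : ℝ, ∀ z ∈ CStrip, ‖G z‖ ≤ B

lemma isOpen_Strip : IsOpen Strip :=
  (isOpen_lt continuous_const Complex.continuous_im).inter (isOpen_lt Complex.continuous_im continuous_const)

lemma Strip_subset : Strip ⊆ CStrip := fun _ h => ⟨h.1.le, h.2.le⟩

lemma Nice.mul {G H : ℂ → ℂ} (hG : Nice G) (hH : Nice H) : Nice (fun z => G z * H z) := by
  refine ⟨hG.cont.mul hH.cont, hG.diff.mul hH.diff, ?_⟩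
  obtain ⟨A, hA⟩ := hG.bdd
  obtain ⟨B, hB⟩ := hH.bdd
  refine ⟨A * B, fun z hz => ?_⟩
  rw [norm_mul]
  exact mul_le_mul (hA z hz) (hB z hz) (norm_nonneg _) ((norm_nonneg _).trans (hA z hz))

lemma Nice.sub {G H : ℂ → ℂ} (hG : Nice G) (hH : Nice H) : Nice (fun z => G z - H z) := by
  refine ⟨hG.cont.sub hH.cont, hG.diff.sub hH.diff, ?_⟩
  obtain ⟨A, hA⟩ := hG.bdd
  obtain ⟨B, hB⟩ := hH.bdd
  exact ⟨A + B, fun z hz => (norm_sub_le _ _).trans (add_le_add (hA z hz) (hB z hz))⟩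

lemma line_mem {x y : ℝ} (h0 : 0 ≤ y) (h1 : y ≤ 1) : (x : ℂ) + y * I ∈ CStrip := by
  simp [CStrip, h0, h1]

lemma line_mem' {x y : ℝ} (h0 : 0 < y) (h1 : y < 1) : (x : ℂ) + y * I ∈ Strip := by
  simp [Strip, h0, h1]

lemma line0_mem (x : ℝ) : (x : ℂ) ∈ CStrip := by simp [CStrip]
lemma line1_mem (x : ℝ) : (x : ℂ) + I ∈ CStrip := by simp [CStrip]

lemma Nice.cont_line {G : ℂ → ℂ} (hG : Nice G) {y : ℝ} (h0 : 0 ≤ y) (h1 : y ≤ 1) :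
    Continuous (fun x : ℝ => G (x + y * I)) :=
  hG.cont.comp_continuous (by fun_prop) fun x => line_mem h0 h1

lemma Nice.cont0 {G : ℂ → ℂ} (hG : Nice G) : Continuous (fun x : ℝ => G x) :=
  hG.cont.comp_continuous (by fun_prop) line0_mem

lemma Nice.cont1 {G : ℂ → ℂ} (hG : Nice G) : Continuous (fun x : ℝ => G (x + I)) :=
  hG.cont.comp_continuous (by fun_prop) line1_mem

lemma contour_aux {G : ℂ → ℂ} (hc : ContinuousOn G CStrip) (hd : DifferentiableOn ℂ G Strip)
    (b : ℝ → ℝ) (hb : Tendsto b atTop (𝓝 0))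
    (hGb : ∀ x y : ℝ, 0 ≤ y → y ≤ 1 → ‖G (x + y * I)‖ ≤ b |x|)
    (h0 : Integrable (fun x : ℝ => G x) volume) (h1 : Integrable (fun x : ℝ => G (x + I)) volume) :
    ∫ x : ℝ, G x = ∫ x : ℝ, G (x + I) := by
  have hrect : ∀ R : ℝ, 0 < R → (∫ x : ℝ in (-R)..R, G x) - (∫ x : ℝ in (-R)..R, G (x + I)) +
      I • (∫ y : ℝ in (0:ℝ)..1, G (R + y * I)) - I • (∫ y : ℝ in (0:ℝ)..1, G ((-R : ℝ) + y * I)) = 0 := by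
    intro R hR
    have := integral_boundary_rect_eq_zero_of_continuousOn_of_differentiableOn G ((-R : ℝ) : ℂ) ((R : ℂ) + I) ?_ ?_
    · simpa using this
    · refine hc.mono ?_
      intro z hz
      rw [Complex.mem_reProdIm] at hz
      have h := hz.2
      simp only [ofReal_im, add_im, I_im, zero_add, uIcc_of_le zero_le_one] at h
      exact h
    · refine hd.mono ?_
      intro z hz
      rw [Complex.mem_reProdIm] at hz
      have h := hz.2
      simp only [ofReal_im, add_im, I_im, zero_add] at h
      have h3 : 0 < z.im ∧ z.im < 1 := by simpa using h
      exact h3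
  have hv : ∀ s : ℝ, |s| = 1 → Tendsto (fun R : ℝ => I • (∫ y : ℝ in (0:ℝ)..1, G ((s * R : ℝ) + y * I))) atTop (𝓝 0) := by
    intro s hs
    rw [tendsto_zero_iff_norm_tendsto_zero]
    refine squeeze_zero' (Eventually.of_forall fun _ => norm_nonneg _) ?_ hb
    filter_upwards [eventually_gt_atTop 0] with R hR
    rw [norm_smul, norm_I, one_mul]
    have := intervalIntegral.norm_integral_le_of_norm_le_const (a := (0:ℝ)) (b := 1) (C := b R)
      (f := fun y : ℝ => G ((s * R : ℝ) + y * I)) ?_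
    · simpa using this
    · intro y hy
      rw [uIoc_of_le zero_le_one] at hy
      have := hGb (s * R) y hy.1.le hy.2
      rwa [abs_mul, hs, one_mul, abs_of_pos hR] at this
  have hR0 := intervalIntegral_tendsto_integral h0 tendsto_neg_atTop_atBot tendsto_id
  have hR1 := intervalIntegral_tendsto_integral h1 tendsto_neg_atTop_atBot tendsto_id
  have ht := ((hR0.sub hR1).add (hv 1 (by simp))).sub (hv (-1) (by simp))
  have hz : Tendsto (fun _ : ℝ => (0:ℂ)) atTop (𝓝 ((∫ x : ℝ, G x) - (∫ x : ℝ, G (x + I)) + 0 - 0)) := by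
    refine ht.congr' ?_
    filter_upwards [eventually_gt_atTop 0] with R hR
    rw [← hrect R hR]
    simp
  have := tendsto_nhds_unique hz tendsto_const_nhds
  simp only [add_zero, sub_zero] at this
  exact sub_eq_zero.mp this

lemma wt_norm {δ : ℝ} (hδ : 0 ≤ δ) {x y : ℝ} (hy : 0 ≤ y) :
    1 + δ ^ 2 * x ^ 2 ≤ ‖(1 - δ * I * ((x : ℂ) + y * I)) ^ 2‖ := by
  have e : (1 - δ * I * ((x : ℂ) + y * I)) = ((1 + δ * y : ℝ) : ℂ) + ((-(δ * x) : ℝ) : ℂ) * I := by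
    push_cast
    have := I_mul_I
    linear_combination (-(δ:ℂ) * y) * this
  rw [norm_pow, e, ← Complex.normSq_eq_norm_sq, Complex.normSq_add_mul_I]
  have : 0 ≤ δ * y := by positivity
  nlinarith

lemma wt_ne {δ : ℝ} (hδ : 0 ≤ δ) {z : ℂ} (hz : z ∈ CStrip) : (1 - δ * I * z) ^ 2 ≠ 0 := by
  have h := wt_norm (x := z.re) hδ hz.1
  rw [re_add_im] at h
  intro h0
  rw [h0, norm_zero] at h
  have : 0 ≤ δ ^ 2 * z.re ^ 2 := by positivity
  linarith

lemma contour {G : ℂ → ℂ} (hG : Nice G)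
    (h0 : Integrable (fun x : ℝ => G x) volume) (h1 : Integrable (fun x : ℝ => G (x + I)) volume) :
    ∫ x : ℝ, G x = ∫ x : ℝ, G (x + I) := by
  obtain ⟨B, hB⟩ := hG.bdd
  have hB0 : 0 ≤ B := (norm_nonneg _).trans (hB 0 (by simp [CStrip]))
  let W : ℝ → ℂ → ℂ := fun δ z => ((1 - δ * I * z) ^ 2)⁻¹
  have hW1 : ∀ δ : ℝ, 0 ≤ δ → ∀ z ∈ CStrip, ‖W δ z‖ ≤ 1 := by
    intro δ hδ z hz
    have h := wt_norm (x := z.re) hδ hz.1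
    rw [re_add_im] at h
    simp only [W, norm_inv]
    refine inv_le_one_of_one_le₀ (le_trans ?_ h)
    have : 0 ≤ δ ^ 2 * z.re ^ 2 := by positivity
    linarith
  have hWc : ∀ δ : ℝ, 0 ≤ δ → ContinuousOn (W δ) CStrip := fun δ hδ =>
    ContinuousOn.inv₀ (by fun_prop) fun z hz => wt_ne hδ hz
  have hW0i : ∀ δ : ℝ, 0 ≤ δ → Integrable (fun x : ℝ => G x * W δ x) volume := by
    intro δ hδ
    refine h0.mono (hG.cont0.mul ((hWc δ hδ).comp_continuous (by fun_prop) line0_mem)).aestronglyMeasurable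
      (Eventually.of_forall fun x => ?_)
    rw [norm_mul]
    exact mul_le_of_le_one_right (norm_nonneg _) (hW1 δ hδ _ (line0_mem x))
  have hW1i : ∀ δ : ℝ, 0 ≤ δ → Integrable (fun x : ℝ => G (x + I) * W δ (x + I)) volume := by
    intro δ hδ
    refine h1.mono (hG.cont1.mul ((hWc δ hδ).comp_continuous (by fun_prop) line1_mem)).aestronglyMeasurable
      (Eventually.of_forall fun x => ?_)
    rw [norm_mul]
    exact mul_le_of_le_one_right (norm_nonneg _) (hW1 δ hδ _ (line1_mem x))
  have hδ : ∀ δ : ℝ, 0 < δ → ∫ x : ℝ, G x * W δ x = ∫ x : ℝ, G (x + I) * W δ (x + I) := by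
    intro δ hδ
    refine contour_aux (G := fun z => G z * W δ z) (hG.cont.mul (hWc δ hδ.le)) (hG.diff.mul ?_)
      (fun x => B * (1 + δ ^ 2 * x ^ 2)⁻¹) ?_ ?_ (hW0i δ hδ.le) (hW1i δ hδ.le)
    · exact DifferentiableOn.inv (by fun_prop) fun z hz => wt_ne hδ.le (Strip_subset hz)
    · have : Tendsto (fun x : ℝ => (1 + δ ^ 2 * x ^ 2)⁻¹) atTop (𝓝 0) := by
        refine tendsto_inv_atTop_zero.comp ?_
        refine tendsto_atTop_add_const_left _ _ ?_
        exact (tendsto_pow_atTop two_ne_zero).const_mul_atTop (by positivity)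
      simpa using this.const_mul B
    · intro x y hy0 hy1
      rw [norm_mul]
      refine mul_le_mul (hB _ (line_mem hy0 hy1)) ?_ (norm_nonneg _) hB0
      simp only [W, norm_inv, sq_abs]
      exact inv_anti₀ (by positivity) (wt_norm hδ.le hy0)
  have hlim : ∀ (γ : ℝ → ℂ) (_ : ∀ x, γ x ∈ CStrip) (_ : Continuous γ) (_ : Integrable (fun x => G (γ x)) volume),
      Tendsto (fun δ : ℝ => ∫ x, G (γ x) * W δ (γ x)) (𝓝[>] 0) (𝓝 (∫ x, G (γ x))) := by
    intro γ hγ hγc hi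
    refine tendsto_integral_filter_of_dominated_convergence (fun x => ‖G (γ x)‖) ?_ ?_ hi.norm ?_
    · filter_upwards [self_mem_nhdsWithin] with δ hδ
      exact hi.1.mul ((hWc δ (le_of_lt hδ)).comp_continuous hγc hγ).aestronglyMeasurable
    · filter_upwards [self_mem_nhdsWithin] with δ hδ
      refine Eventually.of_forall fun x => ?_
      rw [norm_mul]
      exact mul_le_of_le_one_right (norm_nonneg _) (hW1 δ (le_of_lt hδ) _ (hγ x))
    · refine Eventually.of_forall fun x => ?_
      have hc : ContinuousAt (fun δ : ℝ => G (γ x) * W δ (γ x)) 0 := by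
        refine continuousAt_const.mul (ContinuousAt.inv₀ (by fun_prop) (by simp))
      have := hc.tendsto
      simp only [W, ofReal_zero, zero_mul, sub_zero, one_pow, inv_one, mul_one] at this
      exact this.mono_left nhdsWithin_le_nhds
  have hl0 := hlim (fun x => (x : ℂ)) line0_mem (by fun_prop) h0
  have hl1 := hlim (fun x => (x : ℂ) + I) line1_mem (by fun_prop) h1
  refine tendsto_nhds_unique hl0 (hl1.congr' ?_)
  filter_upwards [self_mem_nhdsWithin] with δ h
  exact (hδ δ h).symm

/-! ### Poisson type representation -/

def kerA (y : ℝ) (t : ℝ) : ℂ := (y : ℂ) / (π * ((t : ℂ) ^ 2 + y ^ 2))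

def kerB (y : ℝ) (t : ℝ) : ℂ := -((y : ℂ) / (π * (((t : ℂ) - I) ^ 2 + y ^ 2)))

lemma den0_ne {y : ℝ} (hy : 0 < y) (t : ℝ) : ((t : ℂ) ^ 2 + y ^ 2) ≠ 0 := by
  have : (t ^ 2 + y ^ 2 : ℝ) ≠ 0 := by positivity
  exact_mod_cast this

lemma norm_den1 {y : ℝ} (hy : 0 < y) (hy1 : y < 1) (t s : ℝ) (hs : s = 1 ∨ s = -1) :
    (1 - y) * (1 + t ^ 2) ≤ ‖((t : ℂ) + s * I) ^ 2 + y ^ 2‖ := by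
  have e : ((t : ℂ) + s * I) ^ 2 + y ^ 2 = ((t ^ 2 - s ^ 2 + y ^ 2 : ℝ) : ℂ) + ((2 * t * s : ℝ) : ℂ) * I := by
    push_cast
    have := I_sq
    linear_combination (s : ℂ) ^ 2 * this
  rw [e]
  refine (pow_le_pow_iff_left₀ (mul_nonneg (sub_pos.mpr hy1).le (by positivity)) (norm_nonneg _) two_ne_zero).mp ?_
  rw [← Complex.normSq_eq_norm_sq, Complex.normSq_add_mul_I]
  have hs2 : s ^ 2 = 1 := by rcases hs with h | h <;> simp [h]
  have e2 : (2 * t * s) ^ 2 = 4 * t ^ 2 := by rw [mul_pow, hs2]; ring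
  rw [e2, hs2]
  nlinarith [mul_pos hy (sub_pos.mpr hy1), sq_nonneg t, sq_nonneg (t^2), mul_nonneg (sq_nonneg t) (mul_pos hy (sub_pos.mpr hy1)).le, mul_nonneg (sq_nonneg (t^2)) (mul_pos hy (sub_pos.mpr hy1)).le, mul_nonneg (sq_nonneg t) hy.le, sq_nonneg y, mul_nonneg (sq_nonneg (t^2)) hy.le, mul_pos hy hy, mul_pos (mul_pos hy hy) (sub_pos.mpr hy1), mul_nonneg (mul_nonneg (sq_nonneg t) hy.le) hy.le]

lemma den1_ne {y : ℝ} (hy : 0 < y) (hy1 : y < 1) (t s : ℝ) (hs : s = 1 ∨ s = -1) :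
    ((t : ℂ) + s * I) ^ 2 + y ^ 2 ≠ 0 := by
  intro h
  have := norm_den1 hy hy1 t s hs
  rw [h, norm_zero] at this
  have h2 : 0 < (1 - y) * (1 + t ^ 2) := mul_pos (sub_pos.mpr hy1) (by positivity)
  linarith

lemma integrable_K0 {y : ℝ} (hy : 0 < y) : Integrable (fun x : ℝ => (y : ℂ) / ((x : ℂ) ^ 2 + y ^ 2)) volume := by
  have h := ((integrable_inv_one_add_sq).comp_div hy.ne').const_mul y⁻¹
  have h2 := h.ofReal (𝕜 := ℂ)
  refine h2.congr (Eventually.of_forall fun x => ?_)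
  have : y⁻¹ * (1 + (x / y) ^ 2)⁻¹ = y / (x ^ 2 + y ^ 2) := by
    have : x ^ 2 + y ^ 2 ≠ 0 := by positivity
    field_simp
    ring
  simp only [this]
  push_cast
  rfl

lemma integral_K0 {y : ℝ} (hy : 0 < y) : ∫ x : ℝ, (y : ℂ) / ((x : ℂ) ^ 2 + y ^ 2) = π := by
  have h : ∀ x : ℝ, (y : ℂ) / ((x : ℂ) ^ 2 + y ^ 2) = ((y⁻¹ * (1 + (x / y) ^ 2)⁻¹ : ℝ) : ℂ) := by
    intro x
    have : y⁻¹ * (1 + (x / y) ^ 2)⁻¹ = y / (x ^ 2 + y ^ 2) := by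
      have : x ^ 2 + y ^ 2 ≠ 0 := by positivity
      field_simp
      ring
    rw [this]; push_cast; rfl
  simp_rw [h]
  rw [show (∫ x : ℝ, ((y⁻¹ * (1 + (x / y) ^ 2)⁻¹ : ℝ) : ℂ)) = ((∫ x : ℝ, y⁻¹ * (1 + (x / y) ^ 2)⁻¹ : ℝ) : ℂ) from integral_ofReal, integral_const_mul, Measure.integral_comp_div (fun x : ℝ => (1 + x ^ 2)⁻¹) y, integral_univ_inv_one_add_sq, abs_of_pos hy, smul_eq_mul]
  rw [← mul_assoc, inv_mul_cancel₀ hy.ne', one_mul]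

lemma norm_K1_le {y : ℝ} (hy : 0 < y) (hy1 : y < 1) (x s : ℝ) (hs : s = 1 ∨ s = -1) :
    ‖(y : ℂ) / (((x : ℂ) + s * I) ^ 2 + y ^ 2)‖ ≤ y / (1 - y) * (1 + x ^ 2)⁻¹ := by
  rw [norm_div, norm_real, Real.norm_of_nonneg hy.le]
  have h2 : 0 < (1 - y) * (1 + x ^ 2) := mul_pos (sub_pos.mpr hy1) (by positivity)
  refine (div_le_div_of_nonneg_left hy.le h2 (norm_den1 hy hy1 x s hs)).trans (le_of_eq ?_)
  rw [div_mul_eq_div_div, div_eq_mul_inv _ (1 + x ^ 2)]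

lemma continuous_K1 {y : ℝ} (hy : 0 < y) (hy1 : y < 1) (s : ℝ) (hs : s = 1 ∨ s = -1) :
    Continuous (fun x : ℝ => (y : ℂ) / (((x : ℂ) + s * I) ^ 2 + y ^ 2)) :=
  Continuous.div (by fun_prop) (by fun_prop) fun x => den1_ne hy hy1 x s hs

lemma integrable_K1 {y : ℝ} (hy : 0 < y) (hy1 : y < 1) (s : ℝ) (hs : s = 1 ∨ s = -1) :
    Integrable (fun x : ℝ => (y : ℂ) / (((x : ℂ) + s * I) ^ 2 + y ^ 2)) volume :=
  ((integrable_inv_one_add_sq).const_mul (y / (1 - y))).mono'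
    (continuous_K1 hy hy1 s hs).aestronglyMeasurable
    (Eventually.of_forall fun x => norm_K1_le hy hy1 x s hs)

lemma integral_K1 {y : ℝ} (hy : 0 < y) (hy1 : y < 1) :
    ∫ x : ℝ, (y : ℂ) / (((x : ℂ) + I) ^ 2 + y ^ 2) = 0 := by
  have hi := integrable_K1 hy hy1 1 (Or.inl rfl)
  simp only [ofReal_one, one_mul] at hi
  have hn2 : ∀ x : ℝ, (x : ℂ) + (1 + y) * I ≠ 0 := by
    intro x h
    have := congrArg Complex.im h
    simp at this
    linarith
  have hn1 : ∀ x : ℝ, (x : ℂ) + (1 - y) * I ≠ 0 := by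
    intro x h
    have := congrArg Complex.im h
    simp at this
    linarith
  let ρ : ℝ → ℂ := fun x => ((x : ℂ) + (1 - y) * I) / ((x : ℂ) + (1 + y) * I)
  have hρre : ∀ x, 0 < (ρ x).re := by
    intro x
    simp only [ρ]
    rw [Complex.div_re, ← add_div]
    refine div_pos ?_ (Complex.normSq_pos.mpr (hn2 x))
    simp
    nlinarith [mul_pos hy hy, mul_self_nonneg x]
  have hρd : ∀ x : ℝ, HasDerivAt ρ ((2 * y * I) / ((x : ℂ) + (1 + y) * I) ^ 2) x := by
    intro x
    have h1 : HasDerivAt (fun x : ℝ => (x : ℂ) + (1 - y) * I) 1 x := (ofRealCLM.hasDerivAt).add_const _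
    have h2 : HasDerivAt (fun x : ℝ => (x : ℂ) + (1 + y) * I) 1 x := (ofRealCLM.hasDerivAt).add_const _
    refine (h1.div h2 (hn2 x)).congr_deriv ?_
    congr 1
    ring
  have hl : ∀ x : ℝ, HasDerivAt (fun x => (1 / (2 * I)) * Complex.log (ρ x)) ((y : ℂ) / (((x : ℂ) + I) ^ 2 + y ^ 2)) x := by
    intro x
    have h := ((hρd x).clog_real (Or.inl (hρre x))).const_mul (1 / (2 * I))
    refine h.congr_deriv ?_
    have e : ((x : ℂ) + I) ^ 2 + y ^ 2 = ((x : ℂ) + (1 - y) * I) * ((x : ℂ) + (1 + y) * I) := by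
      have := I_sq
      linear_combination (y : ℂ) ^ 2 * this
    rw [e]
    have a := hn1 x
    have b := hn2 x
    simp only [ρ]
    field_simp
  have hlim : ∀ l : Filter ℝ, Tendsto (fun x : ℝ => ‖x‖) l atTop →
      Tendsto (fun x => (1 / (2 * I)) * Complex.log (ρ x)) l (𝓝 0) := by
    intro l hl
    have h1 : Tendsto ρ l (𝓝 1) := by
      have : ρ = fun x : ℝ => 1 - 2 * y * I * ((x : ℂ) + (1 + y) * I)⁻¹ := by
        funext x
        have := hn2 x
        simp only [ρ]
        rw [div_eq_iff this]
        linear_combination (2 * y * I) * (inv_mul_cancel₀ this)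
      rw [this]
      have h0 : Tendsto (fun x : ℝ => ((x : ℂ) + (1 + y) * I)⁻¹) l (𝓝 0) := by
        refine tendsto_inv₀_cobounded.comp ?_
        rw [← tendsto_norm_atTop_iff_cobounded]
        refine tendsto_atTop_mono (fun x => ?_) hl
        have := Complex.abs_re_le_norm ((x : ℂ) + (1 + y) * I)
        simpa using this
      simpa using (h0.const_mul (2 * y * I)).const_sub 1
    have h2 : Tendsto (fun x => Complex.log (ρ x)) l (𝓝 (Complex.log 1)) :=
      (continuousAt_clog (by simp)).tendsto.comp h1
    simpa using h2.const_mul (1 / (2 * I))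
  have := integral_of_hasDerivAt_of_tendsto hl hi (hlim _ tendsto_abs_atBot_atTop) (hlim _ tendsto_abs_atTop_atTop)
  simpa using this

lemma Nice.bdd_pos {G : ℂ → ℂ} (hG : Nice G) : ∃ B : ℝ, 0 ≤ B ∧ ∀ z ∈ CStrip, ‖G z‖ ≤ B := by
  obtain ⟨B, hB⟩ := hG.bdd
  exact ⟨B, (norm_nonneg _).trans (hB 0 (by simp [CStrip])), hB⟩

lemma nice_dslope {G : ℂ → ℂ} (hG : Nice G) {z0 : ℂ} (hz : z0 ∈ Strip) : Nice (dslope G z0) := by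
  obtain ⟨B, hB0, hB⟩ := hG.bdd_pos
  have hnh : Strip ∈ 𝓝 z0 := isOpen_Strip.mem_nhds hz
  have hnh' : CStrip ∈ 𝓝 z0 := Filter.mem_of_superset hnh Strip_subset
  have hda : DifferentiableAt ℂ G z0 := hG.diff.differentiableAt hnh
  have hc : ContinuousOn (dslope G z0) CStrip := (continuousOn_dslope hnh').mpr ⟨hG.cont, hda⟩
  refine ⟨hc, (Complex.differentiableOn_dslope hnh).mpr hG.diff, ?_⟩
  obtain ⟨δ, hδ, hsub⟩ := Metric.nhds_basis_closedBall.mem_iff.mp hnh'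
  obtain ⟨A, hA⟩ := (isCompact_closedBall z0 δ).exists_bound_of_continuousOn (hc.mono hsub)
  refine ⟨max A ((B + B) / δ), fun z hzm => ?_⟩
  by_cases hzb : z ∈ Metric.closedBall z0 δ
  · exact (hA z hzb).trans (le_max_left _ _)
  · refine le_trans ?_ (le_max_right _ _)
    have hd : δ < ‖z - z0‖ := by
      rw [Metric.mem_closedBall, not_le, dist_eq_norm] at hzb
      exact hzb
    have hne : z ≠ z0 := by
      rintro rfl
      simp at hd
      linarith
    rw [dslope_of_ne _ hne, slope_def_field, norm_div]
    exact div_le_div₀ (by linarith) ((norm_sub_le _ _).trans (add_le_add (hB z hzm) (hB z0 (Strip_subset hz)))) hδ hd.le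

lemma nice_K {y : ℝ} (hy : 0 < y) : Nice (fun z => (y : ℂ) / (z + y * I)) := by
  have hge : ∀ z ∈ CStrip, y ≤ ‖z + y * I‖ := by
    intro z hz
    have := (le_abs_self _).trans (Complex.abs_im_le_norm (z + y * I))
    simp at this
    linarith [hz.1]
  have hne : ∀ z ∈ CStrip, z + y * I ≠ 0 := by
    intro z hz h
    have := hge z hz
    rw [h, norm_zero] at this
    linarith
  refine ⟨ContinuousOn.div (by fun_prop) (by fun_prop) hne, DifferentiableOn.div (by fun_prop) (by fun_prop) fun z hz => hne z (Strip_subset hz), 1, fun z hz => ?_⟩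
  rw [norm_div, norm_real, Real.norm_of_nonneg hy.le]
  exact div_le_one_of_le₀ (hge z hz) (norm_nonneg _)

lemma rep0 {G : ℂ → ℂ} (hG : Nice G) {y : ℝ} (hy : 0 < y) (hy1 : y < 1) :
    π * G (y * I) = (∫ x : ℝ, G x * ((y : ℂ) / ((x : ℂ) ^ 2 + y ^ 2))) -
      ∫ x : ℝ, G (x + I) * ((y : ℂ) / (((x : ℂ) + I) ^ 2 + y ^ 2)) := by
  obtain ⟨B, hB0, hB⟩ := hG.bdd_pos
  have hz0 : (y * I : ℂ) ∈ Strip := by simpa using line_mem' (x := 0) hy hy1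
  have hΦ := (nice_dslope hG hz0).mul (nice_K hy)
  have hform : ∀ z ∈ CStrip, z ≠ y * I → dslope G (y * I) z * ((y : ℂ) / (z + y * I)) =
      (G z - G (y * I)) * ((y : ℂ) / (z ^ 2 + y ^ 2)) := by
    intro z hz hne
    rw [dslope_of_ne _ hne, slope_def_field]
    have e : z ^ 2 + y ^ 2 = (z - y * I) * (z + y * I) := by
      have := I_sq
      linear_combination (y : ℂ) ^ 2 * this
    rw [e, div_mul_div_comm, mul_div_assoc]
  have i0 := integrable_K0 hy
  have i1 := integrable_K1 hy hy1 1 (Or.inl rfl)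
  simp only [ofReal_one, one_mul] at i1
  have f0 : ∀ x : ℝ, dslope G (y * I) x * ((y : ℂ) / (x + y * I)) =
      G x * ((y : ℂ) / ((x : ℂ) ^ 2 + y ^ 2)) - G (y * I) * ((y : ℂ) / ((x : ℂ) ^ 2 + y ^ 2)) := by
    intro x
    rw [hform _ (line0_mem x), sub_mul]
    intro h
    have := congrArg Complex.im h
    simp at this
    linarith
  have f1 : ∀ x : ℝ, dslope G (y * I) (x + I) * ((y : ℂ) / ((x + I) + y * I)) =
      G (x + I) * ((y : ℂ) / (((x : ℂ) + I) ^ 2 + y ^ 2)) - G (y * I) * ((y : ℂ) / (((x : ℂ) + I) ^ 2 + y ^ 2)) := by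
    intro x
    rw [hform _ (line1_mem x), sub_mul]
    intro h
    have := congrArg Complex.im h
    simp at this
    linarith
  have j0 : Integrable (fun x : ℝ => G x * ((y : ℂ) / ((x : ℂ) ^ 2 + y ^ 2))) volume :=
    i0.bdd_mul hG.cont0.aestronglyMeasurable (Eventually.of_forall fun x => hB _ (line0_mem x))
  have j1 : Integrable (fun x : ℝ => G (x + I) * ((y : ℂ) / (((x : ℂ) + I) ^ 2 + y ^ 2))) volume :=
    i1.bdd_mul hG.cont1.aestronglyMeasurable (Eventually.of_forall fun x => hB _ (line1_mem x))
  have hcon := contour hΦ (by simp_rw [f0]; exact j0.sub (i0.const_mul _)) (by simp_rw [f1]; exact j1.sub (i1.const_mul _))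
  simp_rw [f0, f1] at hcon
  rw [integral_sub j0 (i0.const_mul _), integral_sub j1 (i1.const_mul _), integral_const_mul, integral_const_mul, integral_K0 hy, integral_K1 hy hy1] at hcon
  linear_combination -hcon

lemma Nice.translate {G : ℂ → ℂ} (hG : Nice G) (a : ℝ) : Nice (fun z => G (z + a)) := by
  have h1 : ∀ z ∈ CStrip, z + a ∈ CStrip := fun z hz => by simpa [CStrip] using hz
  have h2 : ∀ z ∈ Strip, z + a ∈ Strip := fun z hz => by simpa [Strip] using hz
  obtain ⟨B, hB⟩ := hG.bdd
  exact ⟨hG.cont.comp (by fun_prop) h1, hG.diff.comp (by fun_prop) h2, B, fun z hz => hB _ (h1 z hz)⟩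

lemma Nice.refl {G : ℂ → ℂ} (hG : Nice G) : Nice (fun z => G (I - z)) := by
  have h1 : ∀ z ∈ CStrip, I - z ∈ CStrip := fun z hz => by
    simp only [CStrip, mem_ofPred_eq, sub_im, I_im]; constructor <;> linarith [hz.1, hz.2]
  have h2 : ∀ z ∈ Strip, I - z ∈ Strip := fun z hz => by
    simp only [Strip, mem_ofPred_eq, sub_im, I_im]; constructor <;> linarith [hz.1, hz.2]
  obtain ⟨B, hB⟩ := hG.bdd
  exact ⟨hG.cont.comp (by fun_prop) h1, hG.diff.comp (by fun_prop) h2, B, fun z hz => hB _ (h1 z hz)⟩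

lemma rep {G : ℂ → ℂ} (hG : Nice G) {y : ℝ} (hy : 0 < y) (hy1 : y < 1) (x : ℝ) :
    G (x + y * I) = cv (kerA y) (fun t => G t) 1 x + cv (kerB y) (fun t => G (t + I)) 1 x := by
  have h := rep0 (hG.translate x) hy hy1
  have hpi : (π : ℂ) ≠ 0 := by exact_mod_cast Real.pi_ne_zero
  rw [← mul_right_inj' hpi, add_comm (x : ℂ), h, mul_add, sub_eq_add_neg]
  unfold cv kerA kerB
  congr 1
  · rw [← integral_const_mul, ← integral_neg_eq_self]
    refine integral_congr_ae (Eventually.of_forall fun t => ?_)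
    have := den0_ne hy t
    simp only [ofReal_neg, ofReal_sub, ofReal_mul, ofReal_one, one_mul, neg_sq]
    rw [show (-(t : ℂ) + x) = x - t by ring]
    field_simp
  · rw [← integral_const_mul, ← integral_neg_eq_self, ← integral_neg]
    refine integral_congr_ae (Eventually.of_forall fun t => ?_)
    have := den1_ne hy hy1 t (-1) (Or.inr rfl)
    have e : (t : ℂ) + ((-1 : ℝ) : ℂ) * I = t - I := by push_cast; ring
    rw [e] at this
    simp only [ofReal_neg, ofReal_sub, ofReal_mul, ofReal_one, one_mul]
    rw [show (-(t : ℂ) + I + x) = x - t + I by ring, show (-(t : ℂ) + I) ^ 2 = (t - I) ^ 2 by ring]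
    field_simp

lemma memLp_of_bdd_int {u : ℝ → ℂ} (hu : Integrable u volume) {B : ℝ} (hB : ∀ x, ‖u x‖ ≤ B)
    {r : ℝ≥0∞} (hr : 1 ≤ r) : MemLp u r volume := by
  by_cases hrt : r = ∞
  · subst hrt
    exact memLp_top_of_bound hu.1 B (Eventually.of_forall hB)
  have hr1 : 1 ≤ r.toReal := by
    have := ENNReal.toReal_mono hrt hr
    simpa using this
  rw [← integrable_norm_rpow_iff hu.1 (by positivity) hrt]
  have hB0 : 0 ≤ B := (norm_nonneg _).trans (hB 0)
  refine (hu.norm.const_mul (B ^ (r.toReal - 1))).mono' ?_ (Eventually.of_forall fun x => ?_)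
  · exact (hu.1.norm.aemeasurable.pow_const _).aestronglyMeasurable
  · rw [Real.norm_of_nonneg (by positivity)]
    rcases eq_or_lt_of_le (norm_nonneg (u x)) with h | h
    · rw [← h, Real.zero_rpow (by linarith)]; simp
    · have : ‖u x‖ ^ r.toReal = ‖u x‖ ^ (r.toReal - 1) * ‖u x‖ := by
        conv_rhs => rw [← Real.rpow_add_one h.ne']
        congr 1; ring
      rw [this]
      gcongr
      exact hB x

lemma kerA_eq {y : ℝ} (t : ℝ) : kerA y t = (π : ℂ)⁻¹ * ((y : ℂ) / ((t : ℂ) ^ 2 + y ^ 2)) := by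
  unfold kerA
  rw [← div_div, div_eq_mul_inv (y : ℂ) π, mul_comm (y : ℂ), mul_div_assoc]

lemma kerB_eq {y : ℝ} (t : ℝ) : kerB y t = -(π : ℂ)⁻¹ * ((y : ℂ) / (((t : ℂ) + ((-1 : ℝ) : ℂ) * I) ^ 2 + y ^ 2)) := by
  unfold kerB
  rw [show (t : ℂ) + ((-1 : ℝ) : ℂ) * I = t - I by push_cast; ring]
  rw [← div_div, div_eq_mul_inv (y : ℂ) π, mul_comm (y : ℂ), mul_div_assoc]
  ring

lemma kerA_int {y : ℝ} (hy : 0 < y) : Integrable (kerA y) volume := by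
  rw [show kerA y = _ from funext kerA_eq]
  exact (integrable_K0 hy).const_mul _

lemma kerA_integral {y : ℝ} (hy : 0 < y) : ∫ t, kerA y t = 1 := by
  simp_rw [kerA_eq]
  rw [integral_const_mul, integral_K0 hy]
  exact inv_mul_cancel₀ (by exact_mod_cast Real.pi_ne_zero)

lemma kerA_norm {y : ℝ} (hy : 0 < y) (t : ℝ) : kerA y t = (‖kerA y t‖ : ℂ) := by
  have : kerA y t = ((y / (π * (t ^ 2 + y ^ 2)) : ℝ) : ℂ) := by unfold kerA; push_cast; rfl
  rw [this, norm_real, Real.norm_of_nonneg (by positivity)]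

lemma kerA_lint {y : ℝ} (hy : 0 < y) : ∫⁻ t, ‖kerA y t‖ₑ = 1 := by
  have h := ofReal_integral_norm_eq_lintegral_enorm (kerA_int hy)
  rw [← h]
  have h2 : ((∫ t, ‖kerA y t‖ : ℝ) : ℂ) = 1 := by
    rw [← kerA_integral hy, ← integral_complex_ofReal]
    exact integral_congr_ae (Eventually.of_forall fun t => (kerA_norm hy t).symm)
  have h3 : ∫ t, ‖kerA y t‖ = 1 := by exact_mod_cast h2
  simp [h3]

lemma kerA_bdd {y : ℝ} (hy : 0 < y) (t : ℝ) : ‖kerA y t‖ ≤ π⁻¹ * y⁻¹ := by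
  have : kerA y t = ((y / (π * (t ^ 2 + y ^ 2)) : ℝ) : ℂ) := by unfold kerA; push_cast; rfl
  rw [this, norm_real, Real.norm_of_nonneg (by positivity), ← mul_inv, div_le_iff₀ (by positivity)]
  have : y = (π * y)⁻¹ * (π * y ^ 2) := by field_simp
  conv_lhs => rw [this]
  gcongr
  nlinarith [sq_nonneg t]

lemma kerA_memLp {y : ℝ} (hy : 0 < y) {r : ℝ≥0∞} (hr : 1 ≤ r) : MemLp (kerA y) r volume :=
  memLp_of_bdd_int (kerA_int hy) (kerA_bdd hy) hr

lemma kerB_int {y : ℝ} (hy : 0 < y) (hy1 : y < 1) : Integrable (kerB y) volume := by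
  rw [show kerB y = _ from funext kerB_eq]
  exact (integrable_K1 hy hy1 (-1) (Or.inr rfl)).const_mul _

lemma kerB_bdd {y : ℝ} (hy : 0 < y) (hy1 : y < 1) (t : ℝ) : ‖kerB y t‖ ≤ π⁻¹ * (y / (1 - y) * (1 + t ^ 2)⁻¹) := by
  rw [kerB_eq, norm_mul, norm_neg, norm_inv, norm_real, Real.norm_of_nonneg Real.pi_pos.le]
  gcongr
  exact norm_K1_le hy hy1 t (-1) (Or.inr rfl)

lemma kerB_lint {y : ℝ} (hy : 0 < y) (hy1 : y < 1) : ∫⁻ t, ‖kerB y t‖ₑ ≤ ENNReal.ofReal (y / (1 - y)) := by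
  rw [← ofReal_integral_norm_eq_lintegral_enorm (kerB_int hy hy1)]
  refine ENNReal.ofReal_le_ofReal ?_
  refine (integral_mono (kerB_int hy hy1).norm ((integrable_inv_one_add_sq.const_mul _).const_mul _) (kerB_bdd hy hy1)).trans (le_of_eq ?_)
  rw [integral_const_mul, integral_const_mul, integral_univ_inv_one_add_sq]
  have := Real.pi_ne_zero
  field_simp

lemma kerB_memLp {y : ℝ} (hy : 0 < y) (hy1 : y < 1) {r : ℝ≥0∞} (hr : 1 ≤ r) : MemLp (kerB y) r volume := by
  refine memLp_of_bdd_int (kerB_int hy hy1) (B := π⁻¹ * (y / (1 - y) * 1)) (fun t => (kerB_bdd hy hy1 t).trans ?_) hr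
  have : 0 < 1 - y := sub_pos.mpr hy1
  gcongr
  exact inv_le_one_of_one_le₀ (by nlinarith [sq_nonneg t])

lemma cv_kerA_scale {y : ℝ} (hy : 0 < y) (u : ℝ → ℂ) (x : ℝ) : cv (kerA y) u 1 x = cv (kerA 1) u y x := by
  unfold cv
  have h := Measure.integral_comp_mul_left (fun t : ℝ => u (x - 1 * t) * kerA y t) y
  have h2 : ∀ t : ℝ, u (x - y * t) * kerA 1 t = y • (u (x - 1 * (y * t)) * kerA y (y * t)) := by
    intro t
    rw [one_mul, real_smul, mul_left_comm]
    congr 1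
    unfold kerA
    have h1 := den0_ne one_pos t
    have h3 := den0_ne hy (y * t)
    have hyc : (y : ℂ) ≠ 0 := by exact_mod_cast hy.ne'
    push_cast at *
    have hpi : (π : ℂ) ≠ 0 := by exact_mod_cast Real.pi_ne_zero
    field_simp
  simp_rw [h2]
  rw [integral_smul, h, abs_of_pos (inv_pos.mpr hy), smul_smul, mul_inv_cancel₀ hy.ne', one_smul]

lemma cv_swap (κ u : ℝ → ℂ) (x : ℝ) : cv κ u 1 x = ∫ t, u t * κ (x - t) := by
  unfold cv
  rw [← integral_sub_left_eq_self (fun t => u t * κ (x - t)) volume x]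
  simp

lemma memLp_flip {κ : ℝ → ℂ} {r : ℝ≥0∞} (h : MemLp κ r volume) (x : ℝ) : MemLp (fun t => κ (x - t)) r volume :=
  h.comp_measurePreserving (Measure.measurePreserving_sub_left volume x)

lemma eLpNorm_flip {κ : ℝ → ℂ} {r : ℝ≥0∞} (h : AEStronglyMeasurable κ volume) (x : ℝ) :
    eLpNorm (fun t => κ (x - t)) r volume = eLpNorm κ r volume :=
  eLpNorm_comp_measurePreserving h (Measure.measurePreserving_sub_left volume x)

lemma norm_exp_N {N : ℝ} {z : ℂ} : ‖Complex.exp (I * N * z)‖ = Real.exp (-(N * z.im)) := by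
  rw [Complex.norm_exp]
  congr 1
  simp [mul_re]

lemma Nice.exp {G : ℂ → ℂ} (hG : Nice G) {N : ℝ} (hN : 0 ≤ N) : Nice (fun z => G z * Complex.exp (I * N * z)) := by
  refine hG.mul ⟨by fun_prop, by fun_prop, 1, fun z hz => ?_⟩
  rw [norm_exp_N]
  exact Real.exp_le_one_iff.mpr (by nlinarith [hz.1, mul_nonneg hN hz.1])

/-- Main pointwise estimate: the upper boundary contributes an arbitrarily small amount. -/
lemma exprep {r s : ℝ≥0∞} (hs : 1 ≤ s) (hc : r⁻¹ + s⁻¹ = 1) {G : ℂ → ℂ} (hG : Nice G) {y : ℝ} (hy : 0 < y) (hy1 : y < 1)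
    (x : ℝ) {N : ℝ} (hN : 0 ≤ N) {c : ℝ} (hGm : eLpNorm (fun t : ℝ => G (t + I)) r volume ≤ ENNReal.ofReal c) (hc0 : 0 ≤ c) :
    ‖G (x + y * I) - ∫ t : ℝ, G t * (Complex.exp (I * N * (t - (x + y * I))) * kerA y (x - t))‖ ≤
      Real.exp (-(N * (1 - y))) * (c * (eLpNorm (kerB y) s volume).toReal) := by
  have h := rep (hG.exp hN) hy hy1 x
  set E := Complex.exp (I * N * ((x : ℂ) + y * I)) with hE
  have hE0 : E ≠ 0 := Complex.exp_ne_zero _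
  have hsplit : ∀ w : ℂ, Complex.exp (I * N * w) = E * Complex.exp (I * N * (w - (x + y * I))) := by
    intro w
    rw [hE, ← Complex.exp_add]
    congr 1; ring
  rw [cv_swap, cv_swap] at h
  have h2 : G (x + y * I) = (∫ t : ℝ, G t * (Complex.exp (I * N * (t - (x + y * I))) * kerA y (x - t))) +
      ∫ t : ℝ, G (t + I) * (Complex.exp (I * N * (t + I - (x + y * I))) * kerB y (x - t)) := by
    have e0 : ∀ t : ℝ, G t * Complex.exp (I * N * t) * kerA y (x - t) =
        E * (G t * (Complex.exp (I * N * (t - (x + y * I))) * kerA y (x - t))) := by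
      intro t; rw [hsplit]; ring
    have e1 : ∀ t : ℝ, G (t + I) * Complex.exp (I * N * (t + I)) * kerB y (x - t) =
        E * (G (t + I) * (Complex.exp (I * N * (t + I - (x + y * I))) * kerB y (x - t))) := by
      intro t; rw [hsplit]; ring
    simp_rw [e0, e1] at h
    rw [integral_const_mul, integral_const_mul, ← mul_add, mul_comm (G _)] at h
    exact mul_left_cancel₀ hE0 h
  rw [h2, add_sub_cancel_left]
  have e2 : ∀ t : ℝ, Complex.exp (I * N * (t + I - (x + y * I))) = Complex.exp (-(N * (1 - y)) : ℝ) * Complex.exp (I * N * ((t - x : ℝ) : ℂ)) := by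
    intro t
    rw [← Complex.exp_add]
    congr 1
    push_cast
    have := I_sq
    linear_combination ((N : ℂ) * (1 - y)) * this
  have e3 : ∀ t : ℝ, G (t + I) * (Complex.exp (I * N * (t + I - (x + y * I))) * kerB y (x - t)) =
      Complex.exp (-(N * (1 - y)) : ℝ) * (G (t + I) * (Complex.exp (I * N * ((t - x : ℝ) : ℂ)) * kerB y (x - t))) := by
    intro t; rw [e2]; ring
  simp_rw [e3]
  rw [integral_const_mul, norm_mul, ← Complex.ofReal_exp, norm_real, Real.norm_of_nonneg (Real.exp_pos _).le]
  gcongr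
  have hκ : MemLp (fun t => kerB y (x - t)) s volume := memLp_flip (kerB_memLp hy hy1 hs) x
  have hn : ∀ t : ℝ, ‖Complex.exp (I * N * ((t - x : ℝ) : ℂ)) * kerB y (x - t)‖ = ‖kerB y (x - t)‖ := by
    intro t; rw [norm_mul, norm_exp_N, ofReal_im]; simp
  have hv : AEStronglyMeasurable (fun t : ℝ => Complex.exp (I * N * ((t - x : ℝ) : ℂ)) * kerB y (x - t)) volume :=
    (Continuous.aestronglyMeasurable (by fun_prop)).mul hκ.1
  have hen : eLpNorm (fun t : ℝ => Complex.exp (I * N * ((t - x : ℝ) : ℂ)) * kerB y (x - t)) s volume = eLpNorm (kerB y) s volume := by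
    rw [eLpNorm_congr_norm_ae (Eventually.of_forall hn), eLpNorm_flip (kerB_memLp hy hy1 hs).1]
  refine (holder_norm hc ⟨hG.cont1.aestronglyMeasurable, hGm.trans_lt ENNReal.ofReal_lt_top⟩ ⟨hv, by rw [hen]; exact (kerB_memLp hy hy1 hs).2⟩).trans ?_
  rw [hen]
  gcongr
  exact ENNReal.toReal_le_of_le_ofReal hc0 hGm

/-! ### Mollification of Hardy functions -/

lemma fatou {u : ℕ → ℝ → ℂ} {v : ℝ → ℂ} {r C : ℝ≥0∞} (hu : ∀ n, AEStronglyMeasurable (u n) volume)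
    (hlim : ∀ x, Tendsto (fun n => u n x) atTop (𝓝 (v x))) (hC : ∀ n, eLpNorm (u n) r volume ≤ C) :
    eLpNorm v r volume ≤ C := by
  refine (Lp.eLpNorm_lim_le_liminf_eLpNorm hu v (Eventually.of_forall hlim)).trans ?_
  refine (liminf_le_liminf (Eventually.of_forall hC)).trans ?_
  simp

lemma MemHardy.decomp {p q : ℝ≥0∞} {h : ℂ → ℂ} (hh : MemHardy p q h) :
    ∃ M : ℝ, 0 ≤ M ∧ ∀ y : ℝ, 0 < y → y < 1 → ∃ a b : ℝ → ℂ, Measurable a ∧ Measurable b ∧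
      a + b = bLine h y ∧ eLpNorm a p volume ≤ ENNReal.ofReal (M * (1 - y)) ∧
      eLpNorm b q volume ≤ ENNReal.ofReal (M * y) := by
  refine ⟨(hardyNorm p q h).toReal + 1, by positivity, fun y hy hy1 => ?_⟩
  have hlt : (⨅ (f : ℝ → ℂ) (g : ℝ → ℂ) (_ : Measurable f) (_ : Measurable g)
      (_ : f + g = bLine h y),
      ENNReal.ofReal (1 - y)⁻¹ * eLpNorm f p volume +
        ENNReal.ofReal y⁻¹ * eLpNorm g q volume) < ENNReal.ofReal ((hardyNorm p q h).toReal + 1) := by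
    have h1 : (⨅ (f : ℝ → ℂ) (g : ℝ → ℂ) (_ : Measurable f) (_ : Measurable g)
      (_ : f + g = bLine h y),
      ENNReal.ofReal (1 - y)⁻¹ * eLpNorm f p volume +
        ENNReal.ofReal y⁻¹ * eLpNorm g q volume) ≤ hardyNorm p q h :=
      le_iSup₂ (f := fun (y : ℝ) (_ : y ∈ Set.Ioo (0:ℝ) 1) => ⨅ (f : ℝ → ℂ) (g : ℝ → ℂ) (_ : Measurable f) (_ : Measurable g)
      (_ : f + g = bLine h y),
      ENNReal.ofReal (1 - y)⁻¹ * eLpNorm f p volume +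
        ENNReal.ofReal y⁻¹ * eLpNorm g q volume) y ⟨hy, hy1⟩
    refine h1.trans_lt ?_
    rw [ENNReal.lt_ofReal_iff_toReal_lt hh.2.ne]
    linarith
  simp only [iInf_lt_iff] at hlt
  obtain ⟨a, b, ha, hb, hab, hl⟩ := hlt
  refine ⟨a, b, ha, hb, hab, ?_, ?_⟩
  · have h2 := (le_self_add.trans hl.le)
    have hy' : 0 < 1 - y := sub_pos.mpr hy1
    rw [ENNReal.ofReal_inv_of_pos hy', mul_comm, ← div_eq_mul_inv] at h2
    have := (ENNReal.div_le_iff (by simpa using hy1) ENNReal.ofReal_ne_top).mp h2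
    rwa [← ENNReal.ofReal_mul (by positivity)] at this
  · have h2 := (le_add_self.trans hl.le)
    rw [ENNReal.ofReal_inv_of_pos hy, mul_comm, ← div_eq_mul_inv] at h2
    have := (ENNReal.div_le_iff (by simpa using hy) ENNReal.ofReal_ne_top).mp h2
    rwa [← ENNReal.ofReal_mul (by positivity)] at this

lemma cv_point {r s : ℝ≥0∞} (hc : r⁻¹ + s⁻¹ = 1) {κ u : ℝ → ℂ} (hκ : MemLp κ s volume) {c : ℝ} (hc0 : 0 ≤ c)
    (hu : AEStronglyMeasurable u volume) (hun : eLpNorm u r volume ≤ ENNReal.ofReal c) (x : ℝ) :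
    Integrable (fun t => u t * κ (x - t)) volume ∧ ‖cv κ u 1 x‖ ≤ c * (eLpNorm κ s volume).toReal := by
  have hu' : MemLp u r volume := ⟨hu, hun.trans_lt ENNReal.ofReal_lt_top⟩
  refine ⟨holder_integrable hc hu' (memLp_flip hκ x), ?_⟩
  rw [cv_swap]
  refine (holder_norm hc hu' (memLp_flip hκ x)).trans ?_
  rw [eLpNorm_flip hκ.1]
  gcongr
  exact ENNReal.toReal_le_of_le_ofReal hc0 hun

lemma cv_add {κ a b : ℝ → ℂ} {x : ℝ} (ha : Integrable (fun t => a t * κ (x - t)) volume)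
    (hb : Integrable (fun t => b t * κ (x - t)) volume) :
    cv κ (a + b) 1 x = cv κ a 1 x + cv κ b 1 x := by
  simp only [cv_swap, Pi.add_apply, add_mul]
  exact integral_add ha hb

/-- mollified function -/
def Hm (κ : ℝ → ℂ) (h : ℂ → ℂ) (z : ℂ) : ℂ := ∫ t : ℝ, h (z - t) * κ t

lemma Hm_line (κ : ℝ → ℂ) (h : ℂ → ℂ) (x y : ℝ) : Hm κ h (x + y * I) = cv κ (bLine h y) 1 x := by
  unfold Hm cv bLine
  refine integral_congr_ae (Eventually.of_forall fun t => ?_)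
  simp only
  congr 2
  push_cast; ring

lemma Hm_bdd {p q pst qst : ℝ≥0∞} (hpc : p⁻¹ + pst⁻¹ = 1) (hqc : q⁻¹ + qst⁻¹ = 1) {h : ℂ → ℂ}
    (hh : MemHardy p q h) {κ : ℝ → ℂ} (hκp : MemLp κ pst volume) (hκq : MemLp κ qst volume) :
    ∃ B : ℝ, 0 ≤ B ∧ ∀ z ∈ Strip, ‖Hm κ h z‖ ≤ B := by
  obtain ⟨M, hM, hd⟩ := hh.decomp
  refine ⟨M * (eLpNorm κ pst volume).toReal + M * (eLpNorm κ qst volume).toReal, by positivity, fun z hz => ?_⟩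
  obtain ⟨a, b, ha, hb, hab, hap, hbq⟩ := hd z.im hz.1 hz.2
  rw [← re_add_im z, Hm_line, ← hab]
  have h0 := hz.1
  have h1 := hz.2
  obtain ⟨ia, na⟩ := cv_point hpc hκp (c := M) hM ha.aestronglyMeasurable
    (hap.trans (ENNReal.ofReal_le_ofReal (by nlinarith))) z.re
  obtain ⟨ib, nb⟩ := cv_point hqc hκq (c := M) hM hb.aestronglyMeasurable
    (hbq.trans (ENNReal.ofReal_le_ofReal (by nlinarith))) z.re
  rw [cv_add ia ib]
  exact (norm_add_le _ _).trans (add_le_add na nb)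

lemma sub_mem_Strip {z : ℂ} (hz : z ∈ Strip) (t : ℝ) : z - t ∈ Strip := by
  simpa [Strip] using hz

lemma cont_line_h {h : ℂ → ℂ} (hd : ContinuousOn h Strip) {z : ℂ} (hz : z ∈ Strip) : Continuous (fun t : ℝ => h (z - t)) :=
  hd.comp_continuous (by fun_prop) fun t => sub_mem_Strip hz t

lemma Hm_deriv {h : ℂ → ℂ} (hd : DifferentiableOn ℂ h Strip) {κ : ℝ → ℂ} (hκ : ContDiff ℝ 1 κ) (hκc : HasCompactSupport κ)
    {z : ℂ} (hz : z ∈ Strip) : HasDerivAt (Hm κ h) (Hm (deriv κ) h z) z := by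
  have hdd : ContinuousOn (deriv h) Strip := (hd.deriv isOpen_Strip).continuousOn
  have hha : ∀ w ∈ Strip, HasDerivAt h (deriv h w) w := fun w hw =>
    (hd.differentiableAt (isOpen_Strip.mem_nhds hw)).hasDerivAt
  have hkc' : HasCompactSupport (deriv κ) := hκc.deriv
  have hkd : Continuous (deriv κ) := hκ.continuous_deriv le_rfl
  -- integrability helper
  have h_intg : ∀ (g : ℂ → ℂ), ContinuousOn g Strip → ∀ (k : ℝ → ℂ), Continuous k → HasCompactSupport k →
      ∀ w ∈ Strip, Integrable (fun t : ℝ => g (w - t) * k t) volume := by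
    intro g hg k hk hkc w hw
    exact ((cont_line_h hg hw).mul hk).integrable_of_hasCompactSupport hkc.mul_left
  obtain ⟨δ, hδ, hsub⟩ := Metric.nhds_basis_closedBall.mem_iff.mp (isOpen_Strip.mem_nhds hz)
  -- uniform bound for the derivative
  obtain ⟨A, hA⟩ : ∃ A : ℝ, ∀ w ∈ Metric.closedBall z δ, ∀ t ∈ tsupport κ, ‖deriv h (w - t)‖ ≤ A := by
    have hcpt : IsCompact (Metric.closedBall z δ ×ˢ tsupport κ) := (isCompact_closedBall z δ).prod hκc
    have hcont : ContinuousOn (fun v : ℂ × ℝ => deriv h (v.1 - v.2)) (Metric.closedBall z δ ×ˢ tsupport κ) :=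
      hdd.comp (by fun_prop) fun v hv => sub_mem_Strip (hsub hv.1) _
    obtain ⟨A, hA⟩ := hcpt.exists_bound_of_continuousOn hcont
    exact ⟨A, fun w hw t ht => hA (w, t) ⟨hw, ht⟩⟩
  have key := hasDerivAt_integral_of_dominated_loc_of_deriv_le (μ := (volume : Measure ℝ)) (𝕜 := ℂ)
    (F := fun (w : ℂ) (t : ℝ) => h (w - t) * κ t) (F' := fun (w : ℂ) (t : ℝ) => deriv h (w - t) * κ t)
    (x₀ := z) (s := Metric.closedBall z δ) (bound := fun t => A * ‖κ t‖)
    (Metric.closedBall_mem_nhds z hδ) ?_ (h_intg h hd.continuousOn κ hκ.continuous hκc z hz)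
    (h_intg _ hdd κ hκ.continuous hκc z hz).1 ?_ ((hκ.continuous.integrable_of_hasCompactSupport hκc).norm.const_mul A) ?_
  · have h2 : ∫ t : ℝ, deriv h (z - t) * κ t = Hm (deriv κ) h z := by
      have := integral_mul_deriv_eq_deriv_mul_of_integrable (A := ℂ) (u := fun t : ℝ => h (z - t)) (u' := fun t : ℝ => -deriv h (z - t))
        (v := κ) (v' := deriv κ) ?_ ?_ ?_ ?_ ?_
      · unfold Hm
        rw [this, ← integral_neg]
        simp
      · intro t _
        have h3 := (hha _ (sub_mem_Strip hz t)).scomp t ((ofRealCLM.hasDerivAt (x := t)).const_sub z)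
        have h4 : HasDerivAt (h ∘ fun x : ℝ => z - (x : ℂ)) (-deriv h (z - t)) t := by simpa using h3
        exact h4
      · intro t _
        exact (hκ.differentiable one_ne_zero t).hasDerivAt
      · exact h_intg h hd.continuousOn _ hkd hkc' z hz
      · have := (h_intg _ hdd κ hκ.continuous hκc z hz).neg
        refine this.congr (Eventually.of_forall fun t => ?_)
        simp
      · exact h_intg h hd.continuousOn κ hκ.continuous hκc z hz
    rw [← h2]
    exact key.2
  · filter_upwards [isOpen_Strip.mem_nhds hz] with w hw
    exact (h_intg h hd.continuousOn κ hκ.continuous hκc w hw).1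
  · refine Eventually.of_forall fun t w hw => ?_
    rw [norm_mul]
    by_cases ht : t ∈ tsupport κ
    · gcongr
      exact hA w hw t ht
    · simp [image_eq_zero_of_notMem_tsupport ht]
  · refine Eventually.of_forall fun t w hw => ?_
    have h3 : HasDerivAt (fun w : ℂ => h (w - t)) (deriv h (w - t)) w :=
      (hha _ (sub_mem_Strip (hsub hw) t)).comp_sub_const w (t : ℂ)
    exact h3.mul_const _

lemma Strip_convex : Convex ℝ Strip := by
  have : Strip = Complex.imLm ⁻¹' (Ioo (0:ℝ) 1) := rfl
  rw [this]
  exact (convex_Ioo 0 1).linear_preimage _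

lemma CStrip_sub_closure : CStrip ⊆ closure Strip := by
  have : Strip = (univ : Set ℝ) ×ℂ Ioo (0:ℝ) 1 := by
    ext z; simp [Strip, Complex.mem_reProdIm]
  rw [this, Complex.closure_reProdIm, closure_Ioo zero_ne_one]
  intro z hz
  rw [Complex.mem_reProdIm]
  exact ⟨by simp, hz⟩

/-- The mollification extends to a nice function on the closed strip. -/
lemma moll {p q pst qst : ℝ≥0∞} (hq : 1 ≤ q) (hpc : p⁻¹ + pst⁻¹ = 1) (hqc : q⁻¹ + qst⁻¹ = 1) {h : ℂ → ℂ}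
    (hh : MemHardy p q h) {M : ℝ} (hM : 0 ≤ M) (hd : ∀ y : ℝ, 0 < y → y < 1 → ∃ a b : ℝ → ℂ, Measurable a ∧ Measurable b ∧
      a + b = bLine h y ∧ eLpNorm a p volume ≤ ENNReal.ofReal (M * (1 - y)) ∧
      eLpNorm b q volume ≤ ENNReal.ofReal (M * y))
    {κ : ℝ → ℂ} (hκ : ContDiff ℝ (⊤ : ℕ∞) κ) (hκc : HasCompactSupport κ) :
    ∃ G : ℂ → ℂ, Nice G ∧ (∀ z ∈ Strip, G z = Hm κ h z) ∧
      (∀ h0, IsTrace0 h h0 → ∀ x : ℝ, G x = cv κ h0 1 x) ∧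
      (∀ h1, IsTrace1 h h1 → ∀ x : ℝ, G (x + I) = cv κ h1 1 x) ∧
      eLpNorm (fun x : ℝ => G (x + I)) q volume ≤ (∫⁻ t, ‖κ t‖ₑ) * ENNReal.ofReal M := by
  have hkerB : ContDiff ℝ 1 κ := hκ.of_le (by exact_mod_cast le_top)
  have hmem : ∀ k : ℝ → ℂ, Continuous k → HasCompactSupport k → ∀ r, MemLp k r volume :=
    fun k hk hkc r => hk.memLp_of_hasCompactSupport hkc
  have hkd : Continuous (deriv κ) := hkerB.continuous_deriv le_rfl
  obtain ⟨B, hB0, hB⟩ := Hm_bdd hpc hqc hh (hmem κ hκ.continuous hκc _) (hmem κ hκ.continuous hκc _)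
  obtain ⟨L, hL0, hL⟩ := Hm_bdd hpc hqc hh (hmem _ hkd hκc.deriv _) (hmem _ hkd hκc.deriv _)
  have hder : ∀ z ∈ Strip, HasDerivAt (Hm κ h) (Hm (deriv κ) h z) z := fun z hz => Hm_deriv hh.1 hkerB hκc hz
  have hlip : LipschitzOnWith L.toNNReal (Hm κ h) Strip := by
    refine Strip_convex.lipschitzOnWith_of_nnnorm_deriv_le (𝕜 := ℂ) (fun z hz => (hder z hz).differentiableAt) fun z hz => ?_
    rw [(hder z hz).deriv, ← NNReal.coe_le_coe, coe_nnnorm, Real.coe_toNNReal _ hL0]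
    exact hL z hz
  obtain ⟨G, hG, hGe⟩ := hlip.extend_finite_dimension
  have hGc : Continuous G := hG.continuous
  have hnice : Nice G := by
    refine ⟨hGc.continuousOn, ?_, B, fun z hz => ?_⟩
    · exact DifferentiableOn.congr (fun z hz => (hder z hz).differentiableAt.differentiableWithinAt) fun z hz => (hGe hz).symm
    · have : closure Strip ⊆ {z | ‖G z‖ ≤ B} :=
        closure_minimal (fun w hw => by rw [mem_ofPred_eq, ← hGe hw]; exact hB w hw)
          (isClosed_le hGc.norm continuous_const)
      exact this (CStrip_sub_closure hz)
  -- values on lines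
  have hline : ∀ x y : ℝ, 0 < y → y < 1 → G (x + y * I) = ∫ s : ℝ, h (s + y * I) * κ (x - s) := by
    intro x y h0 h1
    rw [← hGe (line_mem' h0 h1), Hm_line, cv_swap]
    rfl
  have hsch : ∀ x : ℝ, ∃ φ : SchwartzMap ℝ ℂ, ∀ s, (starRingEnd ℂ) (φ s) = κ (x - s) := by
    intro x
    have c1 : HasCompactSupport (fun s : ℝ => (starRingEnd ℂ) (κ (x - s))) := by
      have := (hκc.comp_homeomorph (Homeomorph.subLeft x)).comp_left (g := starRingEnd ℂ) (by simp)
      exact this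
    have c2 : ContDiff ℝ (⊤ : ℕ∞) (fun s : ℝ => (starRingEnd ℂ) (κ (x - s))) :=
      (Complex.conjCLE.contDiff).comp (hκ.comp (by fun_prop))
    exact ⟨c1.toSchwartzMap c2, fun s => by simp⟩
  have hcl : ∀ x : ℝ, ∀ y0 : ℝ, Tendsto (fun y : ℝ => G (x + y * I)) (𝓝 y0) (𝓝 (G (x + y0 * I))) := fun x y0 =>
    (Continuous.tendsto (by fun_prop) y0)
  refine ⟨G, hnice, fun z hz => (hGe hz).symm, ?_, ?_, ?_⟩
  · intro h0 ht x
    obtain ⟨φ, hφ⟩ := hsch x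
    have h1 := ht φ
    simp_rw [hφ] at h1
    have h2 := (hcl x 0).mono_left (nhdsWithin_le_nhds (s := Ioi 0))
    simp only [ofReal_zero, zero_mul, add_zero] at h2
    rw [cv_swap]
    refine tendsto_nhds_unique h2 (h1.congr' ?_)
    filter_upwards [Ioo_mem_nhdsGT zero_lt_one] with y hy
    exact (hline x y hy.1 hy.2).symm
  · intro h0 ht x
    obtain ⟨φ, hφ⟩ := hsch x
    have h1 := ht φ
    simp_rw [hφ] at h1
    have h2 := (hcl x 1).mono_left (nhdsWithin_le_nhds (s := Iio 1))
    simp only [ofReal_one, one_mul] at h2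
    rw [cv_swap]
    refine tendsto_nhds_unique h2 (h1.congr' ?_)
    filter_upwards [Ioo_mem_nhdsLT zero_lt_one] with y hy
    exact (hline x y hy.1 hy.2).symm
  · let yn : ℕ → ℝ := fun n => 1 - 1 / ((n : ℝ) + 2)
    have hyn : ∀ n, 0 < yn n ∧ yn n < 1 := by
      intro n
      have : (0:ℝ) < (n : ℝ) + 2 := by positivity
      constructor
      · simp only [yn, sub_pos]; rw [div_lt_one this]; have : (0:ℝ) ≤ n := by positivity
        linarith
      · simp only [yn]; have : 0 < 1 / ((n : ℝ) + 2) := by positivity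
        linarith
    have hyl : Tendsto yn atTop (𝓝 1) := by
      have : Tendsto (fun n : ℕ => 1 / ((n : ℝ) + 2)) atTop (𝓝 0) := by
        have := (tendsto_natCast_atTop_atTop (R := ℝ)).atTop_add (tendsto_const_nhds (x := (2:ℝ)))
        simpa [Pi.inv_def] using this.inv_tendsto_atTop
      simpa [yn] using this.const_sub 1
    choose a b ha hb hab hap hbq using fun n => hd (yn n) (hyn n).1 (hyn n).2
    have hc1 := fun n x => cv_point hpc (hmem κ hκ.continuous hκc pst) (mul_nonneg hM (by linarith [(hyn n).2])) (ha n).aestronglyMeasurable (hap n) x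
    have hc2 := fun n x => cv_point hqc (hmem κ hκ.continuous hκc qst) (mul_nonneg hM (hyn n).1.le) (hb n).aestronglyMeasurable (hbq n) x
    have hκi := hκ.continuous.integrable_of_hasCompactSupport hκc (μ := volume)
    refine fatou (u := fun n => cv κ (b n) 1) (fun n => cv_aesm hκi.1 (hb n).aestronglyMeasurable) (fun x => ?_) (fun n => ?_)
    · have e : ∀ n, cv κ (b n) 1 x = G (x + yn n * I) - cv κ (a n) 1 x := by
        intro n
        rw [← hGe (line_mem' (hyn n).1 (hyn n).2), Hm_line, ← hab n, cv_add (hc1 n x).1 (hc2 n x).1]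
        ring
      simp_rw [e]
      have l1 := (hcl x 1).comp hyl
      simp only [ofReal_one, one_mul] at l1
      have l2 : Tendsto (fun n => cv κ (a n) 1 x) atTop (𝓝 0) := by
        refine squeeze_zero_norm (fun n => (hc1 n x).2) ?_
        have := ((hyl.const_sub 1).const_mul M).mul_const (eLpNorm κ pst volume).toReal
        simpa using this
      simpa using l1.sub l2
    · refine (young one_ne_zero hq hκi (hb n).aestronglyMeasurable).trans ?_
      gcongr
      refine (hbq n).trans (ENNReal.ofReal_le_ofReal ?_)
      nlinarith [(hyn n).2]

/-! ### A fixed bump, uniqueness and the pairing identity -/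

def bb : ContDiffBump (0:ℝ) := ⟨1, 2, one_pos, one_lt_two⟩

def kb (t : ℝ) : ℂ := ((bb.normed volume t : ℝ) : ℂ)

def sc (ε : ℝ) (κ : ℝ → ℂ) (t : ℝ) : ℂ := ((ε⁻¹ : ℝ) : ℂ) * κ (t / ε)

lemma kb_contDiff : ContDiff ℝ (⊤ : ℕ∞) kb := ofRealCLM.contDiff.comp bb.contDiff_normed

lemma kb_compact : HasCompactSupport kb := bb.hasCompactSupport_normed.comp_left (g := fun x : ℝ => (x : ℂ)) (by simp)

lemma kb_int : Integrable kb volume := kb_contDiff.continuous.integrable_of_hasCompactSupport kb_compact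

lemma kb_integral : ∫ t, kb t = 1 := by
  unfold kb
  rw [integral_complex_ofReal, bb.integral_normed]
  simp

lemma kb_lint : ∫⁻ t, ‖kb t‖ₑ = 1 := by
  rw [← ofReal_integral_norm_eq_lintegral_enorm kb_int]
  have : ∀ t, ‖kb t‖ = bb.normed volume t := by
    intro t; rw [kb, norm_real, Real.norm_of_nonneg (bb.nonneg_normed t)]
  simp_rw [this, bb.integral_normed]
  simp

lemma cv_sc {ε : ℝ} (hε : 0 < ε) (κ u : ℝ → ℂ) : cv κ u ε = cv (sc ε κ) u 1 := by
  funext x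
  unfold cv
  have h := Measure.integral_comp_mul_left (fun t : ℝ => u (x - 1 * t) * sc ε κ t) ε
  have h2 : ∀ t : ℝ, u (x - ε * t) * κ t = ε • (u (x - 1 * (ε * t)) * sc ε κ (ε * t)) := by
    intro t
    unfold sc
    rw [one_mul, real_smul, mul_div_cancel_left₀ _ hε.ne']
    have : (ε : ℂ) ≠ 0 := by exact_mod_cast hε.ne'
    push_cast
    field_simp
  simp_rw [h2]
  rw [integral_smul, h, abs_of_pos (inv_pos.mpr hε), smul_smul, mul_inv_cancel₀ hε.ne', one_smul]

lemma sc_contDiff (ε : ℝ) : ContDiff ℝ (⊤ : ℕ∞) (sc ε kb) :=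
  contDiff_const.mul (kb_contDiff.comp (contDiff_id.div_const ε))

lemma sc_compact {ε : ℝ} (hε : 0 < ε) : HasCompactSupport (sc ε kb) := by
  have : HasCompactSupport (fun t => kb (t / ε)) := by
    have := kb_compact.comp_homeomorph (Homeomorph.mulRight₀ ε⁻¹ (inv_ne_zero hε.ne'))
    simpa [Function.comp_def, div_eq_mul_inv] using this
  exact this.mul_left

lemma sc_lint {ε : ℝ} (hε : 0 < ε) : ∫⁻ t, ‖sc ε kb t‖ₑ = 1 := by
  have hi : Integrable (sc ε kb) volume := (sc_contDiff ε).continuous.integrable_of_hasCompactSupport (sc_compact hε)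
  rw [← ofReal_integral_norm_eq_lintegral_enorm hi]
  have : ∀ t, ‖sc ε kb t‖ = ε⁻¹ * bb.normed volume (t / ε) := by
    intro t
    rw [sc, norm_mul, norm_real, Real.norm_of_nonneg (inv_pos.mpr hε).le, kb, norm_real, Real.norm_of_nonneg (bb.nonneg_normed _)]
  simp_rw [this]
  rw [integral_const_mul, Measure.integral_comp_div (fun x : ℝ => bb.normed volume x) ε, bb.integral_normed, abs_of_pos hε]
  simp [inv_mul_cancel₀ hε.ne']

lemma exp_small {c y : ℝ} (hy1 : y < 1) {a : ℝ} (h : ∀ N : ℝ, 0 ≤ N → a ≤ Real.exp (-(N * (1 - y))) * c) : a ≤ 0 := by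
  have ht : Tendsto (fun N : ℝ => Real.exp (-(N * (1 - y))) * c) atTop (𝓝 0) := by
    have h1 : Tendsto (fun N : ℝ => N * (1 - y)) atTop atTop := tendsto_id.atTop_mul_const (sub_pos.mpr hy1)
    have := (Real.tendsto_exp_neg_atTop_nhds_zero.comp h1).mul_const c
    simpa using this
  refine ge_of_tendsto ht ?_
  filter_upwards [eventually_ge_atTop 0] with N hN
  exact h N hN

lemma hardy_unique {p q pst qst : ℝ≥0∞} (hq : 1 ≤ q) (hpc : p⁻¹ + pst⁻¹ = 1) (hqc : q⁻¹ + qst⁻¹ = 1)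
    {h h' : ℂ → ℂ} (hh : MemHardy p q h) (hh' : MemHardy p q h') {v : ℝ → ℂ} (ht : IsTrace0 h v) (ht' : IsTrace0 h' v) :
    ∀ z ∈ Strip, h z = h' z := by
  obtain ⟨M, hM, hd⟩ := hh.decomp
  obtain ⟨M', hM', hd'⟩ := hh'.decomp
  have hqs := one_le_conj hqc
  have hmoll : ∀ κ : ℝ → ℂ, ContDiff ℝ (⊤ : ℕ∞) κ → HasCompactSupport κ → ∀ z ∈ Strip, Hm κ h z = Hm κ h' z := by
    intro κ hκ hκc z hz
    obtain ⟨G, hG, hGe, hG0, -, hGn⟩ := moll hq hpc hqc hh hM hd hκ hκc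
    obtain ⟨G', hG', hGe', hG0', -, hGn'⟩ := moll hq hpc hqc hh' hM' hd' hκ hκc
    have hκi := hκ.continuous.integrable_of_hasCompactSupport hκc (μ := volume)
    set D : ℂ → ℂ := fun z => G z - G' z with hD
    have hDn : Nice D := hG.sub hG'
    have hfin : eLpNorm (fun t : ℝ => D (t + I)) q volume < ∞ := by
      have := eLpNorm_sub_le hG.cont1.aestronglyMeasurable (hG'.cont1.aestronglyMeasurable (μ := volume)) hq
      refine this.trans_lt (ENNReal.add_lt_top.mpr ⟨hGn.trans_lt ?_, hGn'.trans_lt ?_⟩)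
      · exact ENNReal.mul_lt_top hκi.2 ENNReal.ofReal_lt_top
      · exact ENNReal.mul_lt_top hκi.2 ENNReal.ofReal_lt_top
    have hz0 : ∀ x : ℝ, D x = 0 := fun x => by simp [hD, hG0 v ht x, hG0' v ht' x]
    have : ‖D z‖ ≤ 0 := by
      refine exp_small (y := z.im) (c := (eLpNorm (fun t : ℝ => D (t + I)) q volume).toReal * (eLpNorm (kerB z.im) qst volume).toReal) hz.2 fun N hN => ?_
      have := exprep hqs hqc hDn hz.1 hz.2 z.re hN (ENNReal.ofReal_toReal hfin.ne).ge ENNReal.toReal_nonneg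
      simp_rw [hz0] at this
      simpa using this
    have h0 := norm_le_zero_iff.mp this
    rw [← hGe z hz, ← hGe' z hz]
    exact sub_eq_zero.mp h0
  intro z hz
  have hc1 := cont_line_h hh.1.continuousOn hz
  have hc2 := cont_line_h hh'.1.continuousOn hz
  have hae := ae_eq_zero_of_integral_contDiff_smul_eq_zero (μ := (volume : Measure ℝ)) (f := fun t : ℝ => h (z - t) - h' (z - t))
    (hc1.sub hc2).locallyIntegrable ?_
  · have he : (fun t : ℝ => h (z - t) - h' (z - t)) = fun _ => 0 :=
      ((hc1.sub hc2).ae_eq_iff_eq volume continuous_const).mp hae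
    have := congrFun he 0
    simp only [ofReal_zero, sub_zero] at this
    exact sub_eq_zero.mp this
  · intro g hg hgc
    have h1 : HasCompactSupport (fun t => (g t : ℂ)) := hgc.comp_left (g := fun x : ℝ => (x : ℂ)) (by simp)
    have h2 : ContDiff ℝ (⊤ : ℕ∞) (fun t => (g t : ℂ)) := ofRealCLM.contDiff.comp hg
    have h3 := hmoll _ h2 h1 z hz
    unfold Hm at h3
    have i1 : Integrable (fun t : ℝ => h (z - t) * (g t : ℂ)) volume := (hc1.mul h2.continuous).integrable_of_hasCompactSupport h1.mul_left
    have i2 : Integrable (fun t : ℝ => h' (z - t) * (g t : ℂ)) volume := (hc2.mul h2.continuous).integrable_of_hasCompactSupport h1.mul_left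
    rw [← sub_eq_zero, ← integral_sub i1 i2] at h3
    rw [← h3]
    refine integral_congr_ae (Eventually.of_forall fun t => ?_)
    simp only [real_smul]; ring

/-- One sided pairing inequality with bound `M`. -/
lemma pairing {p q pst qst : ℝ≥0∞} (hp : 1 ≤ p) (hq : 1 ≤ q) (hpc : p⁻¹ + pst⁻¹ = 1) (hqc : q⁻¹ + qst⁻¹ = 1)
    {m h : ℂ → ℂ} (hm : MemHardy pst qst m) (hh : MemHardy p q h) {m0 h0 h1 : ℝ → ℂ} (hm0 : IsTrace0 m m0)
    (hh0 : IsTrace0 h h0) (hh1 : IsTrace1 h h1) (lm0 : MemLp m0 pst volume) (lh0 : MemLp h0 p volume) (lh1 : MemLp h1 q volume)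
    {M : ℝ} (hM : 0 ≤ M) (hd : ∀ y : ℝ, 0 < y → y < 1 → ∃ a b : ℝ → ℂ, Measurable a ∧ Measurable b ∧
      a + b = bLine m y ∧ eLpNorm a pst volume ≤ ENNReal.ofReal (M * (1 - y)) ∧
      eLpNorm b qst volume ≤ ENNReal.ofReal (M * y)) :
    ‖∫ x, m0 x * h0 x‖ ≤ M * (eLpNorm h1 q volume).toReal ∧
    ∀ m1, IsTrace1 m m1 → MemLp m1 qst volume → ∫ x, m0 x * h0 x = ∫ x, m1 x * h1 x := by
  have hps := one_le_conj hpc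
  have hqs := one_le_conj hqc
  have hpc' : pst⁻¹ + p⁻¹ = 1 := by rwa [add_comm]
  have hqc' : qst⁻¹ + q⁻¹ = 1 := by rwa [add_comm]
  obtain ⟨M', hM', hd'⟩ := hh.decomp
  have step : ∀ ε : ℝ, 0 < ε → ∃ g : ℝ → ℂ, MemLp g qst volume ∧ eLpNorm g qst volume ≤ ENNReal.ofReal M ∧
      (∫ x, cv kb m0 ε x * h0 x = ∫ x, g x * h1 x) ∧ ∀ m1, IsTrace1 m m1 → g = cv kb m1 ε := by
    intro ε hε
    obtain ⟨G, hG, -, hG0, hG1, hGn⟩ := moll hqs hpc' hqc' hm hM hd (sc_contDiff ε) (sc_compact hε)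
    rw [sc_lint hε, one_mul] at hGn
    have hGm : MemLp (fun x : ℝ => G (x + I)) qst volume := ⟨hG.cont1.aestronglyMeasurable, hGn.trans_lt ENNReal.ofReal_lt_top⟩
    refine ⟨fun x => G (x + I), hGm, hGn, ?_, ?_⟩
    · have lc : MemLp (cv kb m0 ε) pst volume := cv_memLp hε.ne' hps kb_int lm0
      have e : ∀ δ : ℝ, 0 < δ → ∫ x, cv kb h0 δ x * cv kb m0 ε x = ∫ x, cv kb h1 δ x * G (x + I) := by
        intro δ hδ
        obtain ⟨K, hK, -, hK0, hK1, -⟩ := moll hq hpc hqc hh hM' hd' (sc_contDiff δ) (sc_compact hδ)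
        have e0 : ∀ x : ℝ, cv kb h0 δ x * cv kb m0 ε x = G x * K x := by
          intro x; rw [hG0 _ hm0, hK0 _ hh0, cv_sc hδ, cv_sc hε, mul_comm]
        have e1 : ∀ x : ℝ, cv kb h1 δ x * G (x + I) = G (x + I) * K (x + I) := by
          intro x; rw [hK1 _ hh1, cv_sc hδ, mul_comm]
        have i0 := holder_integrable hpc (cv_memLp hδ.ne' hp kb_int lh0) lc
        have i1 := holder_integrable hqc (cv_memLp hδ.ne' hq kb_int lh1) hGm
        simp_rw [e0] at i0 ⊢
        simp_rw [e1] at i1 ⊢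
        exact contour (hG.mul hK) i0 i1
      have t0 := (tendsto_moll hp hps hpc kb_int kb_integral lh0 lc).mono_left (nhdsWithin_le_nhds (s := Ioi 0))
      have t1 := (tendsto_moll hq hqs hqc kb_int kb_integral lh1 hGm).mono_left (nhdsWithin_le_nhds (s := Ioi 0))
      have := tendsto_nhds_unique t0 (t1.congr' (by filter_upwards [self_mem_nhdsWithin] with δ hδ; exact (e δ hδ).symm))
      simp_rw [mul_comm (cv kb m0 ε _), mul_comm (G _)]
      exact this
    · intro m1 h1t
      funext x
      rw [hG1 _ h1t, cv_sc hε]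
  have t0 := (tendsto_moll hps hp hpc' kb_int kb_integral lm0 lh0).mono_left (nhdsWithin_le_nhds (s := Ioi 0))
  constructor
  · refine le_of_tendsto t0.norm ?_
    filter_upwards [self_mem_nhdsWithin] with ε hε
    obtain ⟨g, hg, hgn, he, -⟩ := step ε hε
    rw [he]
    refine (holder_norm hqc' hg lh1).trans ?_
    gcongr
    exact ENNReal.toReal_le_of_le_ofReal hM hgn
  · intro m1 ht1 lm1
    have t1 := (tendsto_moll hqs hq hqc' kb_int kb_integral lm1 lh1).mono_left (nhdsWithin_le_nhds (s := Ioi 0))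
    refine tendsto_nhds_unique t0 (t1.congr' ?_)
    filter_upwards [self_mem_nhdsWithin] with ε hε
    obtain ⟨g, hg, hgn, he, hg1⟩ := step ε hε
    rw [he, hg1 m1 ht1]

/-! ### Gaussian regularisation -/

/-- Gaussian kernel at scale `ε`. -/
def Ψ (ε : ℝ) (w : ℂ) : ℂ := ((ε⁻¹ * (√π)⁻¹ : ℝ) : ℂ) * Complex.exp (-(w / ε) ^ 2)

def gk (t : ℝ) : ℂ := Ψ 1 t

def dom (x : ℝ) : ℂ := (((1 + x ^ 2)⁻¹ : ℝ) : ℂ)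

lemma dom_norm (x : ℝ) : ‖dom x‖ = (1 + x ^ 2)⁻¹ := by
  rw [dom, norm_real, Real.norm_of_nonneg (by positivity)]

lemma dom_int : Integrable dom volume := integrable_inv_one_add_sq.ofReal

lemma dom_memLp {r : ℝ≥0∞} (hr : 1 ≤ r) : MemLp dom r volume :=
  memLp_of_bdd_int dom_int (B := 1) (fun x => by
    rw [dom_norm]; exact inv_le_one_of_one_le₀ (by nlinarith [sq_nonneg x])) hr

lemma dom_shift {a b : ℝ} (h : |a - b| ≤ 1) : (1 + a ^ 2)⁻¹ ≤ 3 * (1 + b ^ 2)⁻¹ := by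
  rw [← div_eq_mul_inv, le_div_iff₀ (by positivity), inv_mul_le_iff₀ (by positivity)]
  have := abs_le.mp h
  nlinarith [sq_nonneg (a + (a - b)), sq_nonneg (a-b), sq_nonneg (2 * a - b)]

lemma Ψ_cont (ε : ℝ) : Continuous (Ψ ε) := by unfold Ψ; fun_prop

lemma Ψ_deriv (ε : ℝ) (w : ℂ) : HasDerivAt (Ψ ε) (Ψ ε w * (-(2 * w / (ε : ℂ) ^ 2))) w := by
  unfold Ψ
  have h1 : HasDerivAt (fun w : ℂ => -(w / (ε : ℂ)) ^ 2) (-(2 * w / (ε : ℂ) ^ 2)) w := by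
    have h2 : HasDerivAt (fun w : ℂ => w / (ε : ℂ)) (1 / (ε : ℂ)) w := (hasDerivAt_id w).div_const _
    refine (h2.pow 2).neg.congr_deriv ?_
    simp
    by_cases h : (ε : ℂ) = 0
    · simp [h]
    · field_simp
  refine ((h1.cexp).const_mul _).congr_deriv ?_
  ring

lemma Ψ_norm {ε : ℝ} (hε : 0 < ε) (w : ℂ) : ‖Ψ ε w‖ = ε⁻¹ * (√π)⁻¹ * Real.exp (-((w.re ^ 2 - w.im ^ 2) / ε ^ 2)) := by
  unfold Ψ
  rw [norm_mul, norm_real, Real.norm_of_nonneg (by positivity), Complex.norm_exp]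
  congr 2
  have e : w / (ε : ℂ) = ((w.re / ε : ℝ) : ℂ) + ((w.im / ε : ℝ) : ℂ) * I := by
    have : (ε : ℂ) ≠ 0 := by exact_mod_cast hε.ne'
    conv_lhs => rw [← re_add_im w]
    push_cast
    field_simp
  rw [e, neg_re, sq, mul_re]
  simp
  field_simp
  ring

lemma Ψ_bound {ε : ℝ} (hε : 0 < ε) : ∃ C : ℝ, 0 ≤ C ∧ ∀ w : ℂ, |w.im| ≤ 3 →
    ‖Ψ ε w‖ ≤ C * (1 + w.re ^ 2)⁻¹ ∧ ‖Ψ ε w * (-(2 * w / (ε : ℂ) ^ 2))‖ ≤ C * (1 + w.re ^ 2)⁻¹ := by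
  set c : ℝ := min 1 ((ε ^ 2)⁻¹ / 2) with hc
  have hcp : 0 < c := by rw [hc]; positivity
  have hc1 : c ≤ 1 := min_le_left _ _
  have hc2 : c ≤ (ε ^ 2)⁻¹ / 2 := min_le_right _ _
  have hexp : ∀ x : ℝ, Real.exp (-(x ^ 2 / ε ^ 2)) ≤ (c⁻¹) ^ 2 * ((1 + x ^ 2)⁻¹) ^ 2 := by
    intro x
    have h1 : c * (1 + x ^ 2) ≤ Real.exp (x ^ 2 / ε ^ 2 / 2) := by
      have := Real.add_one_le_exp (x ^ 2 / ε ^ 2 / 2)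
      have h3 : c * x ^ 2 ≤ (ε ^ 2)⁻¹ / 2 * x ^ 2 := by gcongr
      have h4 : x ^ 2 / ε ^ 2 / 2 = (ε ^ 2)⁻¹ / 2 * x ^ 2 := by ring
      linarith
    have h2 : Real.exp (x ^ 2 / ε ^ 2) = Real.exp (x ^ 2 / ε ^ 2 / 2) ^ 2 := by
      rw [← Real.exp_nat_mul]; congr 1; push_cast; ring
    rw [Real.exp_neg, h2, ← mul_pow, ← mul_inv, ← inv_pow]
    have h0 : 0 < c * (1 + x ^ 2) := by positivity
    gcongr
  set A : ℝ := ε⁻¹ * (√π)⁻¹ * (Real.exp (9 / ε ^ 2) * (c⁻¹) ^ 2) with hA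
  have hA0 : 0 ≤ A := by positivity
  have hmain : ∀ w : ℂ, |w.im| ≤ 3 → ‖Ψ ε w‖ ≤ A * ((1 + w.re ^ 2)⁻¹) ^ 2 := by
    intro w hw
    rw [Ψ_norm hε, hA, mul_assoc (ε⁻¹ * (√π)⁻¹)]
    gcongr
    have : -((w.re ^ 2 - w.im ^ 2) / ε ^ 2) = w.im ^ 2 / ε ^ 2 + -(w.re ^ 2 / ε ^ 2) := by ring
    rw [this, Real.exp_add, mul_assoc]
    have h9 : w.im ^ 2 ≤ 9 := by
      have := abs_le.mp hw
      nlinarith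
    gcongr
    exact hexp _
  have hle1 : ∀ x : ℝ, ((1 + x ^ 2)⁻¹) ≤ 1 := fun x => inv_le_one_of_one_le₀ (by nlinarith [sq_nonneg x])
  refine ⟨max A (A * (8 / ε ^ 2)), le_max_of_le_left hA0, fun w hw => ⟨?_, ?_⟩⟩
  · refine (hmain w hw).trans ?_
    refine mul_le_mul (le_max_left _ _) ?_ (by positivity) (le_max_of_le_left hA0)
    rw [sq]
    exact mul_le_of_le_one_left (by positivity) (hle1 _)
  · rw [norm_mul, norm_neg, norm_div, norm_mul, norm_pow, norm_real, Real.norm_of_nonneg hε.le]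
    have hn : ‖w‖ ≤ 4 * (1 + w.re ^ 2) := by
      refine (Complex.norm_le_abs_re_add_abs_im w).trans ?_
      nlinarith [sq_nonneg (|w.re| - 1), sq_abs w.re]
    have h2 : ‖(2:ℂ)‖ = 2 := by simp
    rw [h2]
    calc ‖Ψ ε w‖ * (2 * ‖w‖ / ε ^ 2) ≤ (A * ((1 + w.re ^ 2)⁻¹) ^ 2) * (2 * (4 * (1 + w.re ^ 2)) / ε ^ 2) := by
          gcongr
          exact hmain w hw
      _ = A * (8 / ε ^ 2) * (1 + w.re ^ 2)⁻¹ := by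
          have : (1 + w.re ^ 2) ≠ 0 := by positivity
          field_simp
          ring
      _ ≤ _ := by
          gcongr
          exact le_max_right _ _

lemma Ψ_line {ε : ℝ} (y : ℝ) : Continuous (fun t : ℝ => Ψ ε (t + y * I)) := (Ψ_cont ε).comp (by fun_prop)

lemma Ψ_even (ε : ℝ) (w : ℂ) : Ψ ε (-w) = Ψ ε w := by unfold Ψ; congr 2; ring

lemma gk_cont : Continuous gk := (Ψ_cont 1).comp (by fun_prop)

lemma gk_eq (t : ℝ) : gk t = (((√π)⁻¹ * Real.exp (-1 * t ^ 2) : ℝ) : ℂ) := by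
  unfold gk Ψ; push_cast; simp

lemma gk_int : Integrable gk volume := by
  rw [show gk = _ from funext gk_eq]
  exact ((integrable_exp_neg_mul_sq one_pos).const_mul _).ofReal

lemma gk_integral : ∫ t, gk t = 1 := by
  simp_rw [gk_eq]
  rw [integral_complex_ofReal, integral_const_mul, integral_gaussian, div_one,
    inv_mul_cancel₀ (Real.sqrt_pos.mpr Real.pi_pos).ne', ofReal_one]

lemma gk_lint : ∫⁻ t, ‖gk t‖ₑ = 1 := by
  rw [← ofReal_integral_norm_eq_lintegral_enorm gk_int]
  have : ∀ t, ‖gk t‖ = (√π)⁻¹ * Real.exp (-1 * t ^ 2) := by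
    intro t; rw [gk_eq, norm_real, Real.norm_of_nonneg (by positivity)]
  simp_rw [this]
  rw [integral_const_mul, integral_gaussian, div_one,
    inv_mul_cancel₀ (Real.sqrt_pos.mpr Real.pi_pos).ne', ENNReal.ofReal_one]

lemma Ψ_sc {ε : ℝ} : (fun t : ℝ => Ψ ε t) = sc ε gk := by
  funext t
  unfold sc gk Ψ
  push_cast
  simp
  ring

def E (ε : ℝ) (u : ℝ → ℂ) (z : ℂ) : ℂ := ∫ s, u s * Ψ ε (z - s)

lemma E_line (ε : ℝ) (u : ℝ → ℂ) (x y : ℝ) : E ε u (x + y * I) = cv (fun t : ℝ => Ψ ε (t + y * I)) u 1 x := by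
  rw [cv_swap]
  unfold E
  refine integral_congr_ae (Eventually.of_forall fun t => ?_)
  simp only
  congr 2
  push_cast; ring

lemma E_real {ε : ℝ} (hε : 0 < ε) (u : ℝ → ℂ) (x : ℝ) : E ε u x = cv gk u ε x := by
  have := E_line ε u x 0
  simp only [ofReal_zero, zero_mul, add_zero] at this
  rw [this, Ψ_sc, cv_sc hε]

lemma E_deriv {ε : ℝ} (hε : 0 < ε) {r s : ℝ≥0∞} (hs : 1 ≤ s) (hc : r⁻¹ + s⁻¹ = 1) {u : ℝ → ℂ} (hu : MemLp u r volume)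
    {z : ℂ} (hz : |z.im| ≤ 2) : DifferentiableAt ℂ (E ε u) z := by
  obtain ⟨C, hC, hb⟩ := Ψ_bound hε
  have him : ∀ w ∈ Metric.closedBall z 1, |w.im| ≤ 3 := by
    intro w hw
    rw [Metric.mem_closedBall, dist_eq_norm] at hw
    have h1 := (Complex.abs_im_le_norm (w - z)).trans hw
    rw [sub_im] at h1
    rw [abs_le] at *
    constructor <;> linarith [h1.1, h1.2, hz.1, hz.2]
  have hre : ∀ w ∈ Metric.closedBall z 1, ∀ s : ℝ, (1 + (w - s).re ^ 2)⁻¹ ≤ 3 * (1 + (z.re - s) ^ 2)⁻¹ := by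
    intro w hw s
    rw [Metric.mem_closedBall, dist_eq_norm] at hw
    have h1 := (Complex.abs_re_le_norm (w - z)).trans hw
    refine dom_shift ?_
    rw [sub_re] at *
    simpa using h1
  have hdm : Integrable (fun t => u t * dom (z.re - t)) volume := holder_integrable hc hu (memLp_flip (dom_memLp hs) z.re)
  have hmeas : ∀ w : ℂ, AEStronglyMeasurable (fun t : ℝ => u t * Ψ ε (w - t)) volume := fun w =>
    hu.1.mul ((Ψ_cont ε).comp (by fun_prop)).aestronglyMeasurable
  have hbd : ∀ w ∈ Metric.closedBall z 1, ∀ t : ℝ, C * (1 + (w - t).re ^ 2)⁻¹ ≤ 3 * C * ‖dom (z.re - t)‖ := by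
    intro w hw t
    rw [dom_norm]
    have := mul_le_mul_of_nonneg_left (hre w hw t) hC
    linarith
  have him' : ∀ w ∈ Metric.closedBall z 1, ∀ t : ℝ, |(w - t).im| ≤ 3 := by
    intro w hw t
    simpa using him w hw
  have key := hasDerivAt_integral_of_dominated_loc_of_deriv_le (μ := (volume : Measure ℝ)) (𝕜 := ℂ)
    (F := fun (w : ℂ) (t : ℝ) => u t * Ψ ε (w - t))
    (F' := fun (w : ℂ) (t : ℝ) => u t * (Ψ ε (w - t) * (-(2 * (w - t) / (ε : ℂ) ^ 2))))
    (x₀ := z) (s := Metric.closedBall z 1) (bound := fun t => 3 * C * ‖u t * dom (z.re - t)‖)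
    (Metric.closedBall_mem_nhds z one_pos) (Eventually.of_forall hmeas) ?_ ?_ ?_ (hdm.norm.const_mul _) ?_
  · exact key.2.differentiableAt
  · refine (hdm.norm.const_mul (3 * C)).mono' (hmeas z) (Eventually.of_forall fun t => ?_)
    rw [norm_mul, norm_mul]
    have h1 := ((hb _ (him' z (Metric.mem_closedBall_self zero_le_one) t)).1).trans (hbd z (Metric.mem_closedBall_self zero_le_one) t)
    calc ‖u t‖ * ‖Ψ ε (z - t)‖ ≤ ‖u t‖ * (3 * C * ‖dom (z.re - t)‖) := by gcongr
      _ = _ := by ring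
  · refine hu.1.mul (Continuous.aestronglyMeasurable ?_)
    have := Ψ_cont ε
    fun_prop
  · refine Eventually.of_forall fun t w hw => ?_
    rw [norm_mul, norm_mul (u t) (dom _)]
    have h1 := ((hb _ (him' w hw t)).2).trans (hbd w hw t)
    calc ‖u t‖ * ‖Ψ ε (w - t) * (-(2 * (w - t) / (ε : ℂ) ^ 2))‖ ≤ ‖u t‖ * (3 * C * ‖dom (z.re - t)‖) := by gcongr
      _ = _ := by ring
  · refine Eventually.of_forall fun t w hw => ?_
    exact ((Ψ_deriv ε (w - t)).comp_sub_const w (t : ℂ)).const_mul _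

/-- Uniform bounds on horizontal lines. -/
lemma E_bounds {ε : ℝ} (hε : 0 < ε) : ∃ C : ℝ, 0 ≤ C ∧ ∀ y : ℝ, |y| ≤ 1 →
    Integrable (fun t : ℝ => Ψ ε (t + y * I)) volume ∧
    (∀ t : ℝ, ‖Ψ ε (t + y * I)‖ ≤ C * ‖dom t‖) ∧
    (∀ r : ℝ≥0∞, 1 ≤ r → ∀ u : ℝ → ℂ, AEStronglyMeasurable u volume →
      eLpNorm (fun x : ℝ => E ε u (x + y * I)) r volume ≤ ENNReal.ofReal C * (∫⁻ t, ‖dom t‖ₑ) * eLpNorm u r volume) := by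
  obtain ⟨C, hC, hb⟩ := Ψ_bound hε
  refine ⟨C, hC, fun y hy => ?_⟩
  have h1 : ∀ t : ℝ, ‖Ψ ε (t + y * I)‖ ≤ C * ‖dom t‖ := by
    intro t
    have := (hb (t + y * I) (by simp; linarith)).1
    rw [dom_norm]
    simpa using this
  have hi : Integrable (fun t : ℝ => Ψ ε (t + y * I)) volume :=
    (dom_int.norm.const_mul C).mono' (Ψ_line y).aestronglyMeasurable (Eventually.of_forall h1)
  refine ⟨hi, h1, fun r hr u hu => ?_⟩
  simp_rw [E_line]
  refine (young one_ne_zero hr hi hu).trans ?_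
  gcongr
  rw [← lintegral_const_mul' _ _ ENNReal.ofReal_ne_top]
  refine lintegral_mono fun t => ?_
  rw [← ofReal_norm, ← ofReal_norm, ← ENNReal.ofReal_mul hC]
  exact ENNReal.ofReal_le_ofReal (h1 t)

lemma E_nice {ε : ℝ} (hε : 0 < ε) {r s : ℝ≥0∞} (hs : 1 ≤ s) (hc : r⁻¹ + s⁻¹ = 1) {u : ℝ → ℂ} (hu : MemLp u r volume)
    {θ : ℝ} (h0 : 0 ≤ θ) (h1 : θ ≤ 1) : Nice (fun z => E ε u (z - θ * I)) := by
  have him : ∀ z ∈ CStrip, |(z - θ * I).im| ≤ 1 := by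
    intro z hz
    simp
    rw [abs_le]
    constructor <;> linarith [hz.1, hz.2]
  have hd : ∀ z ∈ CStrip, DifferentiableAt ℂ (fun z => E ε u (z - θ * I)) z := by
    intro z hz
    exact DifferentiableAt.comp (g := E ε u) (f := fun z : ℂ => z - θ * I) z
      (E_deriv hε hs hc hu ((him z hz).trans one_le_two)) (by fun_prop)
  obtain ⟨C, hC, hb⟩ := E_bounds hε
  refine ⟨fun z hz => (hd z hz).continuousAt.continuousWithinAt, fun z hz => (hd z (Strip_subset hz)).differentiableWithinAt,
    (eLpNorm u r volume).toReal * (C * (eLpNorm dom s volume).toReal), fun z hz => ?_⟩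
  obtain ⟨hi, hn, -⟩ := hb (z - θ * I).im (him z hz)
  have hel : eLpNorm (fun t : ℝ => Ψ ε (t + (z - θ * I).im * I)) s volume ≤ ENNReal.ofReal C * eLpNorm dom s volume :=
    eLpNorm_le_mul_eLpNorm_of_ae_le_mul (Eventually.of_forall hn) s
  have hfin : ENNReal.ofReal C * eLpNorm dom s volume < ∞ := ENNReal.mul_lt_top ENNReal.ofReal_lt_top (dom_memLp hs).2
  have hm : MemLp (fun t : ℝ => Ψ ε (t + (z - θ * I).im * I)) s volume := ⟨(Ψ_line _).aestronglyMeasurable, hel.trans_lt hfin⟩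
  have := (cv_point hc hm ENNReal.toReal_nonneg hu.1 (ENNReal.ofReal_toReal hu.2.ne).ge (z - θ * I).re).2
  rw [← E_line, re_add_im] at this
  refine this.trans ?_
  gcongr
  have h3 := ENNReal.toReal_mono hfin.ne hel
  rwa [ENNReal.toReal_mul, ENNReal.toReal_ofReal hC] at h3

/-! ### Test functions in the Hardy space -/

lemma cv_adj {r s : ℝ≥0∞} (hc : r⁻¹ + s⁻¹ = 1) {κ u v : ℝ → ℂ} (hκ : Integrable κ volume)
    (hu : MemLp u r volume) (hv : MemLp v s volume) :
    ∫ x, cv κ u 1 x * v x = ∫ x, u x * cv (fun t => κ (-t)) v 1 x := by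
  have f1 := integral_integral_swap (μ := (volume : Measure ℝ)) (ν := (volume : Measure ℝ))
      (f := fun x t => u (x - 1 * t) * κ t * v x) (corr_fubini hc hκ hu hv)
  have hc' : s⁻¹ + r⁻¹ = 1 := by rwa [add_comm]
  have f2 := integral_integral_swap (μ := (volume : Measure ℝ)) (ν := (volume : Measure ℝ))
      (f := fun x t => v (x - 1 * t) * κ (-t) * u x) (corr_fubini (κ := fun t => κ (-t)) hc' hκ.comp_neg hv hu)
  have e1 : ∫ x, cv κ u 1 x * v x = ∫ x, ∫ t, u (x - 1 * t) * κ t * v x := by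
    simp only [cv, ← integral_mul_const]
  have e2 : ∫ x, u x * cv (fun t => κ (-t)) v 1 x = ∫ x, ∫ t, v (x - 1 * t) * κ (-t) * u x := by
    simp only [cv, ← integral_mul_const, mul_comm (u _)]
  rw [e1, e2, f1, f2, ← integral_neg_eq_self]
  congr 1
  funext t
  rw [← integral_add_right_eq_self _ (-t)]
  congr 1
  funext x
  have a1 : x + -t - 1 * -t = x := by ring
  have a2 : x - 1 * t = x + -t := by ring
  rw [a1, a2]; ring

lemma E_adj {ε : ℝ} (hε : 0 < ε) {r s : ℝ≥0∞} (hc : r⁻¹ + s⁻¹ = 1) {φ g : ℝ → ℂ} (hφ : MemLp φ r volume)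
    (hg : MemLp g s volume) :
    ∫ x : ℝ, g x * E ε φ (x - I) = ∫ x : ℝ, E ε g (x + I) * φ x := by
  obtain ⟨C, -, hb⟩ := E_bounds hε
  have hi := (hb (-1) (by simp)).1
  have := cv_adj hc hi hφ hg
  have e1 : ∀ x : ℝ, E ε φ (x - I) = cv (fun t : ℝ => Ψ ε (t + (-1 : ℝ) * I)) φ 1 x := by
    intro x
    rw [← E_line]; congr 1; push_cast; ring
  have e2 : ∀ x : ℝ, E ε g (x + I) = cv (fun t : ℝ => Ψ ε (((-t : ℝ) : ℂ) + (-1 : ℝ) * I)) g 1 x := by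
    intro x
    have h := E_line ε g x 1
    rw [ofReal_one, one_mul] at h
    rw [h]
    congr 1
    funext t
    rw [← Ψ_even]; congr 1; push_cast; ring
  simp_rw [e1, e2]
  rw [← integral_congr_ae (Eventually.of_forall fun x => mul_comm _ _), this]
  exact integral_congr_ae (Eventually.of_forall fun x => mul_comm _ _)

lemma memHardy_of {p q K : ℝ≥0∞} {h : ℂ → ℂ} (hh : Nice h) (hK : K ≠ ∞)
    (hp : ∀ y : ℝ, 0 < y → y < 1 → eLpNorm (bLine h y) p volume ≤ K)
    (hq : ∀ y : ℝ, 0 < y → y < 1 → eLpNorm (bLine h y) q volume ≤ K) : MemHardy p q h := by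
  refine ⟨hh.diff, lt_of_le_of_lt (b := K + K) ?_ (ENNReal.add_lt_top.mpr ⟨hK.lt_top, hK.lt_top⟩)⟩
  unfold hardyNorm
  refine iSup₂_le fun y hy => ?_
  have hm : Measurable (bLine h y) := (hh.cont_line hy.1.le hy.2.le).measurable
  have hsum : ((1 - y : ℝ) : ℂ) • bLine h y + (y : ℂ) • bLine h y = bLine h y := by
    funext x
    simp
    ring
  refine iInf_le_of_le (((1 - y : ℝ) : ℂ) • bLine h y) ?_
  refine iInf_le_of_le ((y : ℂ) • bLine h y) ?_
  refine iInf_le_of_le (hm.const_smul _) ?_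
  refine iInf_le_of_le (hm.const_smul _) ?_
  refine iInf_le_of_le hsum ?_
  · rw [eLpNorm_const_smul, eLpNorm_const_smul]
    have h1 : 0 < 1 - y := by linarith [hy.2]
    have e1 : ∀ c : ℝ, 0 < c → ENNReal.ofReal c⁻¹ * ‖(c : ℂ)‖ₑ = 1 := by
      intro c hc
      rw [← ofReal_norm, norm_real, Real.norm_of_nonneg hc.le, ← ENNReal.ofReal_mul (by positivity),
        inv_mul_cancel₀ hc.ne', ENNReal.ofReal_one]
    rw [← mul_assoc, ← mul_assoc, e1 _ h1, e1 _ hy.1, one_mul, one_mul]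
    exact add_le_add (hp y hy.1 hy.2) (hq y hy.1 hy.2)

lemma Nice.tr {h : ℂ → ℂ} (hh : Nice h) {y0 : ℝ} (h0 : 0 ≤ y0) (h1 : y0 ≤ 1) (φ : SchwartzMap ℝ ℂ) :
    Tendsto (fun y : ℝ => ∫ x : ℝ, h (x + y * I) * (starRingEnd ℂ) (φ x))
      (𝓝[Icc 0 1] y0) (𝓝 (∫ x : ℝ, h (x + y0 * I) * (starRingEnd ℂ) (φ x))) := by
  obtain ⟨B, hB⟩ := hh.bdd
  have hev : ∀ᶠ y in 𝓝[Icc 0 1] y0, y ∈ Icc (0:ℝ) 1 := eventually_mem_nhdsWithin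
  refine tendsto_integral_filter_of_dominated_convergence (fun x => B * ‖φ x‖) ?_ ?_ ?_ ?_
  · filter_upwards [hev] with y hy
    exact ((hh.cont_line hy.1 hy.2).mul (continuous_conj.comp φ.continuous)).aestronglyMeasurable
  · filter_upwards [hev] with y hy
    refine Eventually.of_forall fun x => ?_
    rw [norm_mul, RCLike.norm_conj]
    gcongr
    exact hB _ (line_mem hy.1 hy.2)
  · exact (φ.integrable.norm).const_mul B
  · refine Eventually.of_forall fun x => Tendsto.mul_const _ ?_
    have hc : ContinuousOn (fun y : ℝ => h (x + y * I)) (Icc 0 1) :=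
      hh.cont.comp (by fun_prop) (fun y hy => line_mem hy.1 hy.2)
    exact hc y0 ⟨h0, h1⟩

lemma Nice.trace0 {h : ℂ → ℂ} (hh : Nice h) : IsTrace0 h (fun x => h x) := by
  intro φ
  have := hh.tr le_rfl zero_le_one φ
  simp only [ofReal_zero, zero_mul, add_zero] at this
  refine this.mono_left ?_
  rw [← nhdsWithin_Ioo_eq_nhdsGT (zero_lt_one' ℝ)]
  exact nhdsWithin_mono _ Ioo_subset_Icc_self

lemma Nice.trace1 {h : ℂ → ℂ} (hh : Nice h) : IsTrace1 h (fun x => h (x + I)) := by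
  intro φ
  have := hh.tr zero_le_one le_rfl φ
  simp only [ofReal_one, one_mul] at this
  refine this.mono_left ?_
  rw [← nhdsWithin_Ioo_eq_nhdsLT (zero_lt_one' ℝ)]
  exact nhdsWithin_mono _ Ioo_subset_Icc_self

lemma test_hardy {p q : ℝ≥0∞} (hp : 1 ≤ p) (hq : 1 ≤ q) {ε : ℝ} (hε : 0 < ε) {φ : ℝ → ℂ} (hφ : IsTest φ) :
    ∃ h : ℂ → ℂ, MemHardy p q h ∧ IsTrace0 h (fun x : ℝ => E ε φ (x - I)) ∧ IsTrace1 h (cv gk φ ε) ∧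
      MemLp (fun x : ℝ => E ε φ (x - I)) p volume ∧ MemLp (cv gk φ ε) q volume ∧
      eLpNorm (cv gk φ ε) q volume ≤ eLpNorm φ q volume := by
  have hn : Nice (fun z => E ε φ (z - (1 : ℝ) * I)) :=
    E_nice hε (r := 1) (s := ⊤) le_top (by simp) (hφ.memLp 1) zero_le_one le_rfl
  obtain ⟨C, hC, hb⟩ := E_bounds hε
  have hline : ∀ y : ℝ, bLine (fun z => E ε φ (z - (1 : ℝ) * I)) y = fun x : ℝ => E ε φ (x + ((y - 1 : ℝ) : ℂ) * I) := by
    intro y; funext x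
    have e : (x : ℂ) + y * I - (1 : ℝ) * I = x + ((y - 1 : ℝ) : ℂ) * I := by push_cast; ring
    simp only [bLine, e]
  have hB : ∀ r : ℝ≥0∞, 1 ≤ r → ∀ y : ℝ, 0 ≤ y → y ≤ 1 → eLpNorm (bLine (fun z => E ε φ (z - (1 : ℝ) * I)) y) r volume ≤
      ENNReal.ofReal C * (∫⁻ t, ‖dom t‖ₑ) * eLpNorm φ r volume := by
    intro r hr y h0 h1
    rw [hline]
    exact (hb (y - 1) (by rw [abs_le]; constructor <;> linarith)).2.2 r hr φ hφ.1.aestronglyMeasurable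
  have hfin : ∀ r : ℝ≥0∞, ENNReal.ofReal C * (∫⁻ t, ‖dom t‖ₑ) * eLpNorm φ r volume < ∞ := fun r =>
    ENNReal.mul_lt_top (ENNReal.mul_lt_top ENNReal.ofReal_lt_top dom_int.2) (hφ.memLp r).2
  have e0 : (fun x : ℝ => E ε φ (x - I)) = bLine (fun z => E ε φ (z - (1 : ℝ) * I)) 0 := by
    funext x; simp [bLine]
  have e1 : (fun x : ℝ => E ε φ (x + I - (1 : ℝ) * I)) = cv gk φ ε := by
    funext x
    have e : (x : ℂ) + I - (1 : ℝ) * I = x := by simp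
    rw [← E_real hε, e]
  refine ⟨fun z => E ε φ (z - (1 : ℝ) * I), memHardy_of hn (max_lt (hfin p) (hfin q)).ne
    (fun y h0 h1 => (hB p hp y h0.le h1.le).trans (le_max_left _ _))
    (fun y h0 h1 => (hB q hq y h0.le h1.le).trans (le_max_right _ _)), ?_, ?_, ?_, ?_, ?_⟩
  · have := hn.trace0
    simpa only [ofReal_one, one_mul] using this
  · have := hn.trace1
    rwa [e1] at this
  · rw [e0]
    refine ⟨?_, (hB p hp 0 le_rfl zero_le_one).trans_lt (hfin p)⟩
    exact (hn.cont_line le_rfl zero_le_one).aestronglyMeasurable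
  · exact cv_memLp hε.ne' hq gk_int (hφ.memLp q)
  · have := young hε.ne' hq gk_int hφ.1.aestronglyMeasurable
    rwa [gk_lint, one_mul] at this

/-! ### Optimality of the constant, and locally bounded pointwise limits -/

lemma limit_diff {U : Set ℂ} {G : ℕ → ℂ → ℂ} {m : ℂ → ℂ} (hG : ∀ n, DifferentiableOn ℂ (G n) U)
    (hlim : ∀ z ∈ U, Tendsto (fun n => G n z) atTop (𝓝 (m z)))
    (hb : ∀ z0 ∈ U, ∃ R : ℝ, 0 < R ∧ Metric.closedBall z0 R ⊆ U ∧
      ∃ B : ℝ, ∀ n, ∀ z ∈ Metric.closedBall z0 R, ‖G n z‖ ≤ B) : DifferentiableOn ℂ m U := by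
  intro z0 hz0
  obtain ⟨R, hR, hsub, B, hB⟩ := hb z0 hz0
  have hB0 : 0 ≤ B := (norm_nonneg _).trans (hB 0 z0 (Metric.mem_closedBall_self hR.le))
  have hcm : ∀ θ : ℝ, circleMap z0 R θ ∈ Metric.closedBall z0 R := fun θ => circleMap_mem_closedBall _ hR.le θ
  have hcont : ∀ n, Continuous (fun θ : ℝ => G n (circleMap z0 R θ)) := fun n =>
    ((hG n).continuousOn.mono hsub).comp_continuous (continuous_circleMap _ _) hcm
  have hml : ∀ θ : ℝ, Tendsto (fun n => G n (circleMap z0 R θ)) atTop (𝓝 (m (circleMap z0 R θ))) := fun θ =>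
    hlim _ (hsub (hcm θ))
  have hmm : AEStronglyMeasurable (fun θ : ℝ => m (circleMap z0 R θ)) volume :=
    aestronglyMeasurable_of_tendsto_ae atTop (fun n => (hcont n).aestronglyMeasurable) (Eventually.of_forall hml)
  have hmb : ∀ θ : ℝ, ‖m (circleMap z0 R θ)‖ ≤ B := fun θ =>
    le_of_tendsto (hml θ).norm (Eventually.of_forall fun n => hB n _ (hcm θ))
  have hci : CircleIntegrable m z0 R := by
    refine IntervalIntegrable.mono_fun (g := fun θ : ℝ => m (circleMap z0 R θ)) (f := fun _ : ℝ => B) intervalIntegrable_const hmm.restrict ?_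
    exact Eventually.of_forall fun θ => (hmb θ).trans (le_abs_self B)
  have hrep : ∀ w ∈ Metric.ball z0 R, m w = (2 * π * I : ℂ)⁻¹ • ∮ z in C(z0, R), (z - w)⁻¹ • m z := by
    intro w hw
    have h1 : ∀ n, (2 * π * I : ℂ)⁻¹ • (∮ z in C(z0, R), (z - w)⁻¹ • G n z) = G n w := by
      intro n
      have := ((hG n).mono hsub).circleIntegral_sub_inv_smul hw
      rw [this, inv_smul_smul₀]
      exact two_pi_I_ne_zero
    have h2 : Tendsto (fun n => (2 * π * I : ℂ)⁻¹ • (∮ z in C(z0, R), (z - w)⁻¹ • G n z)) atTop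
        (𝓝 ((2 * π * I : ℂ)⁻¹ • ∮ z in C(z0, R), (z - w)⁻¹ • m z)) := by
      refine Tendsto.const_smul ?_ _
      unfold circleIntegral
      have hne : ∀ θ : ℝ, circleMap z0 R θ - w ≠ 0 := by
        intro θ h
        have : w ∈ Metric.sphere z0 R := by
          rw [← sub_eq_zero.mp h]; exact circleMap_mem_sphere _ hR.le θ
        exact (Metric.sphere_disjoint_ball.le_bot ⟨this, hw⟩)
      have hc : Continuous (fun θ : ℝ => deriv (circleMap z0 R) θ * (circleMap z0 R θ - w)⁻¹) := by
        simp only [deriv_circleMap]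
        have := continuous_circleMap z0 R
        have h0 := continuous_circleMap 0 R
        exact (h0.mul continuous_const).mul ((this.sub continuous_const).inv₀ hne)
      refine intervalIntegral.tendsto_integral_filter_of_dominated_convergence
        (fun θ => ‖deriv (circleMap z0 R) θ * (circleMap z0 R θ - w)⁻¹‖ * B) ?_ ?_ ?_ ?_
      · refine Eventually.of_forall fun n => Continuous.aestronglyMeasurable ?_
        have h3 : Continuous (fun θ : ℝ => deriv (circleMap z0 R) θ * (circleMap z0 R θ - w)⁻¹ * G n (circleMap z0 R θ)) :=
          hc.mul (hcont n)
        simpa only [smul_eq_mul, mul_assoc] using h3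
      · refine Eventually.of_forall fun n => Eventually.of_forall fun θ _ => ?_
        simp only [smul_eq_mul]
        rw [← mul_assoc, norm_mul]
        gcongr
        exact hB n _ (hcm θ)
      · exact (hc.norm.mul continuous_const).intervalIntegrable _ _
      · exact Eventually.of_forall fun θ _ => ((hml θ).const_smul _).const_smul _
    simp_rw [h1] at h2
    exact tendsto_nhds_unique (hlim w (hsub (Metric.ball_subset_closedBall hw))) h2
  lift R to NNReal using hR.le
  have hp := (hasFPowerSeriesOn_cauchy_integral hci (by exact_mod_cast hR)).analyticAt.differentiableAt
  refine (hp.congr_of_eventuallyEq ?_).differentiableWithinAt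
  filter_upwards [Metric.ball_mem_nhds z0 hR] with w hw
  exact hrep w hw

lemma ind_test : IsTest ((Icc (0:ℝ) 1).indicator fun _ => (1:ℂ)) := by
  refine ⟨measurable_const.indicator measurableSet_Icc, 1, 1, fun x => ?_, fun x hx => ?_⟩
  · exact (norm_indicator_le_norm_self _ _).trans (by simp)
  · refine indicator_of_notMem (fun h => ?_) _
    rw [abs_of_nonneg h.1] at hx
    exact absurd h.2 (not_le.mpr hx)

lemma exists_test_pos {q qst : ℝ≥0∞} (hq : 1 ≤ q) (hqc : q⁻¹ + qst⁻¹ = 1) :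
    ∃ ε : ℝ, 0 < ε ∧ 0 < (eLpNorm (cv gk ((Icc (0:ℝ) 1).indicator fun _ => (1:ℂ)) ε) q volume).toReal := by
  by_contra! hcon
  set φ := ((Icc (0:ℝ) 1).indicator fun _ => (1:ℂ)) with hφ
  have hs : 1 ≤ qst := one_le_conj hqc
  have ht := (tendsto_moll hq hs hqc gk_int gk_integral (ind_test.memLp q) (ind_test.memLp qst)).mono_left
    (nhdsWithin_le_nhds (s := Ioi 0))
  have hz : ∀ ε : ℝ, 0 < ε → ∫ x, cv gk φ ε x * φ x = 0 := by
    intro ε hε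
    have h1 := hcon ε hε
    have h2 := holder_norm hqc (cv_memLp hε.ne' hq gk_int (ind_test.memLp q)) (ind_test.memLp qst)
    have h3 : (eLpNorm (cv gk φ ε) q volume).toReal = 0 := le_antisymm h1 ENNReal.toReal_nonneg
    rw [← hφ, h3, zero_mul] at h2
    exact norm_le_zero_iff.mp h2
  have h0 : ∫ x, φ x * φ x = 0 := by
    refine tendsto_nhds_unique ht ?_
    refine tendsto_const_nhds.congr' ?_
    filter_upwards [self_mem_nhdsWithin] with ε hε
    exact (hz ε hε).symm
  have h1 : ∫ x, φ x * φ x = 1 := by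
    have : ∀ x, φ x * φ x = φ x := by
      intro x
      rw [hφ, indicator_apply]
      split_ifs <;> simp
    simp_rw [this, hφ]
    rw [integral_indicator measurableSet_Icc]
    simp
  rw [h0] at h1
  exact zero_ne_one h1

lemma optimal {p q pst qst : ℝ≥0∞} (hp : 1 ≤ p) (hq : 1 ≤ q) (hpc : p⁻¹ + pst⁻¹ = 1) (hqc : q⁻¹ + qst⁻¹ = 1)
    {m : ℂ → ℂ} (hm : MemHardy pst qst m) {m0 m1 : ℝ → ℂ} (hm0 : IsTrace0 m m0) (hm1 : IsTrace1 m m1)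
    (lm0 : MemLp m0 pst volume) (lm1 : MemLp m1 qst volume) {C : ℝ}
    (H : ∀ (h : ℂ → ℂ) (h0 h1 : ℝ → ℂ), MemHardy p q h →
        IsTrace0 h h0 → IsTrace1 h h1 → MemLp h0 p volume → MemLp h1 q volume →
        ‖∫ x : ℝ, m0 x * h0 x‖ ≤ C * (eLpNorm h1 q volume).toReal) :
    (eLpNorm m1 qst volume).toReal ≤ C := by
  obtain ⟨M, hM, hd⟩ := hm.decomp
  have hs : 1 ≤ qst := one_le_conj hqc
  have hC : 0 ≤ C := by
    obtain ⟨ε, hε, hpos⟩ := exists_test_pos hq hqc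
    obtain ⟨h, t1, t2, t3, t4, t5, -⟩ := test_hardy hp hq hε ind_test
    have := (norm_nonneg _).trans (H h _ _ t1 t2 t3 t4 t5)
    exact nonneg_of_mul_nonneg_left this hpos
  have hmain := dual_bound hqc lm1.1 hC (fun φ hφ => ?_)
  · have := ENNReal.toReal_mono ENNReal.ofReal_ne_top hmain
    rwa [ENNReal.toReal_ofReal hC] at this
  · have ht := (tendsto_moll hq hs hqc gk_int gk_integral (hφ.memLp q) lm1).mono_left
      (nhdsWithin_le_nhds (s := Ioi 0))
    have e : ∫ x, m1 x * φ x = ∫ x, φ x * m1 x := integral_congr_ae (Eventually.of_forall fun x => mul_comm _ _)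
    rw [e]
    refine le_of_tendsto ht.norm ?_
    filter_upwards [self_mem_nhdsWithin] with ε hε
    obtain ⟨h, t1, t2, t3, t4, t5, t6⟩ := test_hardy hp hq hε hφ
    have h1 := H h _ _ t1 t2 t3 t4 t5
    have h2 := (pairing hp hq hpc hqc hm t1 hm0 t2 t3 lm0 t4 t5 hM hd).2 m1 hm1 lm1
    have e2 : ∫ x, cv gk φ ε x * m1 x = ∫ x, m1 x * cv gk φ ε x := integral_congr_ae (Eventually.of_forall fun x => mul_comm _ _)
    rw [e2, ← h2]
    refine h1.trans ?_
    gcongr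
    · exact (hφ.memLp q).2.ne

/-! ### Passing to the limit -/

lemma kerA_dom {y : ℝ} (hy : 0 < y) (hy1 : y < 1) (t : ℝ) : ‖kerA y t‖ ≤ y⁻¹ * ‖dom t‖ := by
  have : kerA y t = ((y / (π * (t ^ 2 + y ^ 2)) : ℝ) : ℂ) := by unfold kerA; push_cast; rfl
  rw [this, norm_real, Real.norm_of_nonneg (by positivity), dom_norm, ← mul_inv, div_le_iff₀ (by positivity),
    ← div_eq_inv_mul, le_div_iff₀ (by positivity)]
  have h1 : y * (y * (1 + t ^ 2)) ≤ t ^ 2 + y ^ 2 := by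
    have : y ^ 2 ≤ 1 := by nlinarith
    nlinarith [sq_nonneg t, mul_nonneg (sub_nonneg.mpr this) (sq_nonneg t)]
  have h2 : (1 : ℝ) ≤ π := by linarith [Real.pi_gt_three]
  have h3 : 0 ≤ t ^ 2 + y ^ 2 := by positivity
  nlinarith

lemma kerB_dom {y : ℝ} (hy : 0 < y) (hy1 : y < 1) (t : ℝ) : ‖kerB y t‖ ≤ (1 - y)⁻¹ * ‖dom t‖ := by
  refine (kerB_bdd hy hy1 t).trans ?_
  rw [dom_norm]
  have h1 : 0 < 1 - y := sub_pos.mpr hy1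
  have h2 : π⁻¹ ≤ 1 := inv_le_one_of_one_le₀ (by linarith [Real.pi_gt_three])
  calc π⁻¹ * (y / (1 - y) * (1 + t ^ 2)⁻¹) ≤ 1 * (1 / (1 - y) * (1 + t ^ 2)⁻¹) := by gcongr
    _ = _ := by rw [one_mul, one_div]

lemma toReal_dom_le {κ : ℝ → ℂ} {c : ℝ} (hc : 0 ≤ c) (h : ∀ t, ‖κ t‖ ≤ c * ‖dom t‖) {s : ℝ≥0∞} (hs : 1 ≤ s) :
    (eLpNorm κ s volume).toReal ≤ c * (eLpNorm dom s volume).toReal := by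
  have h1 : eLpNorm κ s volume ≤ ENNReal.ofReal c * eLpNorm dom s volume :=
    eLpNorm_le_mul_eLpNorm_of_ae_le_mul (Eventually.of_forall h) s
  have h3 := ENNReal.toReal_mono (ENNReal.mul_lt_top ENNReal.ofReal_lt_top (dom_memLp hs).2).ne h1
  rwa [ENNReal.toReal_mul, ENNReal.toReal_ofReal hc] at h3

lemma nice_bound {r s p q : ℝ≥0∞} (hp : 1 ≤ p) (hq : 1 ≤ q) (hrp : r⁻¹ + p⁻¹ = 1) (hsq : s⁻¹ + q⁻¹ = 1)
    {G : ℂ → ℂ} (hG : Nice G) {A C : ℝ} (hA0 : 0 ≤ A) (hC0 : 0 ≤ C)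
    (hA : eLpNorm (fun t : ℝ => G t) r volume ≤ ENNReal.ofReal A)
    (hC : eLpNorm (fun t : ℝ => G (t + I)) s volume ≤ ENNReal.ofReal C) {y : ℝ} (hy : 0 < y) (hy1 : y < 1) (x : ℝ) :
    ‖G (x + y * I)‖ ≤ A * (y⁻¹ * (eLpNorm dom p volume).toReal) + C * ((1 - y)⁻¹ * (eLpNorm dom q volume).toReal) := by
  have h1 : 0 < 1 - y := sub_pos.mpr hy1
  rw [rep hG hy hy1 x]
  refine (norm_add_le _ _).trans (add_le_add ?_ ?_)
  · refine (cv_point hrp (kerA_memLp hy hp) hA0 hG.cont0.aestronglyMeasurable hA x).2.trans ?_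
    gcongr
    exact toReal_dom_le (by positivity) (kerA_dom hy hy1) hp
  · refine (cv_point hsq (kerB_memLp hy hy1 hq) hC0 hG.cont1.aestronglyMeasurable hC x).2.trans ?_
    gcongr
    exact toReal_dom_le (by positivity) (kerB_dom hy hy1) hq

lemma kerA_cont {y : ℝ} (hy : 0 < y) : Continuous (kerA y) := by
  unfold kerA
  refine Continuous.div (by fun_prop) (by fun_prop) fun t => ?_
  exact mul_ne_zero (by exact_mod_cast Real.pi_ne_zero) (den0_ne hy t)

lemma cv_meas {κ u : ℝ → ℂ} (hκ : Continuous κ) (hu : Continuous u) : Measurable (cv κ u 1) := by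
  have h : StronglyMeasurable (fun z : ℝ × ℝ => u (z.1 - 1 * z.2) * κ z.2) := by
    refine Continuous.stronglyMeasurable ?_
    fun_prop
  exact h.integral_prod_right'.measurable

lemma half {r s : ℝ≥0∞} (hr : 1 ≤ r) (hs : 1 ≤ s) {G : ℕ → ℂ → ℂ} (hG : ∀ n, Nice (G n)) {A C : ℝ}
    (hA : ∀ n, eLpNorm (fun t : ℝ => G n t) r volume ≤ ENNReal.ofReal A)
    (hC : ∀ n, eLpNorm (fun t : ℝ => G n (t + I)) s volume ≤ ENNReal.ofReal C)
    {y : ℝ} (hy : 0 < y) (hy1 : y < 1) {b α : ℝ → ℂ}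
    (hb : ∀ x : ℝ, Tendsto (fun n => G n (x + y * I)) atTop (𝓝 (b x)))
    (hα : ∀ x : ℝ, Tendsto (fun n => cv (kerA y) (fun t => G n t) 1 x) atTop (𝓝 (α x))) :
    Measurable α ∧ Measurable (b - α) ∧ eLpNorm α r volume ≤ ENNReal.ofReal A ∧
      eLpNorm (b - α) s volume ≤ ENNReal.ofReal (y / (1 - y) * C) := by
  have h1 : 0 < 1 - y := sub_pos.mpr hy1
  have mα : ∀ n, Measurable (cv (kerA y) (fun t => G n t) 1) := fun n => cv_meas (kerA_cont hy) (hG n).cont0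
  have hβ : ∀ x : ℝ, Tendsto (fun n => cv (kerB y) (fun t => G n (t + I)) 1 x) atTop (𝓝 ((b - α) x)) := by
    intro x
    refine ((hb x).sub (hα x)).congr fun n => ?_
    rw [rep (hG n) hy hy1 x, add_sub_cancel_left]
  have e : ∀ n, cv (kerB y) (fun t => G n (t + I)) 1 = fun x : ℝ => G n (x + y * I) - cv (kerA y) (fun t => G n t) 1 x := by
    intro n; funext x
    rw [rep (hG n) hy hy1 x, add_sub_cancel_left]
  have mβ : ∀ n, Measurable (cv (kerB y) (fun t => G n (t + I)) 1) := by
    intro n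
    rw [e n]
    exact ((hG n).cont_line hy.le hy1.le).measurable.sub (mα n)
  refine ⟨measurable_of_tendsto_metrizable mα (tendsto_pi_nhds.mpr hα),
    measurable_of_tendsto_metrizable mβ (tendsto_pi_nhds.mpr hβ), ?_, ?_⟩
  · refine fatou (fun n => (mα n).aestronglyMeasurable) hα fun n => ?_
    have := young one_ne_zero hr (kerA_int hy) (hG n).cont0.aestronglyMeasurable
    rw [kerA_lint hy, one_mul] at this
    exact this.trans (hA n)
  · refine fatou (fun n => (mβ n).aestronglyMeasurable) hβ fun n => ?_
    have := young one_ne_zero hs (kerB_int hy hy1) (hG n).cont1.aestronglyMeasurable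
    refine this.trans ?_
    rw [ENNReal.ofReal_mul (by positivity)]
    exact mul_le_mul' (kerB_lint hy hy1) (hC n)

lemma conv_pt {s p q : ℝ≥0∞} (hp : 1 ≤ p) (hq : 1 ≤ q) (hsq : s⁻¹ + q⁻¹ = 1)
    {G : ℕ → ℂ → ℂ} (hG : ∀ n, Nice (G n)) {C : ℝ} (hC0 : 0 ≤ C)
    (hC : ∀ n, eLpNorm (fun t : ℝ => G n (t + I)) s volume ≤ ENNReal.ofReal C) {g : ℝ → ℂ}
    (hw : ∀ v, MemLp v p volume → Tendsto (fun n => ∫ t : ℝ, G n t * v t) atTop (𝓝 (∫ t, g t * v t)))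
    {y : ℝ} (hy : 0 < y) (hy1 : y < 1) (x : ℝ) : ∃ l, Tendsto (fun n => G n (x + y * I)) atTop (𝓝 l) := by
  refine cauchySeq_tendsto_of_complete ?_
  have h1 : 0 < 1 - y := sub_pos.mpr hy1
  set K := C * (eLpNorm (kerB y) q volume).toReal with hK
  have hK0 : 0 ≤ K := by positivity
  rw [Metric.cauchySeq_iff']
  intro δ hδ
  obtain ⟨N, hN, hNδ⟩ : ∃ N : ℝ, 0 ≤ N ∧ Real.exp (-(N * (1 - y))) * K < δ / 3 := by
    by_contra! hcon
    have := exp_small hy1 (a := δ / 3) hcon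
    linarith
  set v : ℝ → ℂ := fun t => Complex.exp (I * N * (t - (x + y * I))) * kerA y (x - t) with hv
  have hvm : MemLp v p volume := by
    refine MemLp.of_le_mul (c := Real.exp (N * y)) (memLp_flip (kerA_memLp hy hp) x) ?_ ?_
    · have := kerA_cont hy
      exact Continuous.aestronglyMeasurable (by rw [hv]; fun_prop)
    · refine Eventually.of_forall fun t => ?_
      rw [hv]
      simp only
      rw [norm_mul, norm_exp_N]
      simp
  obtain ⟨n0, hn0⟩ := Metric.cauchySeq_iff'.mp (hw v hvm).cauchySeq (δ / 3) (by positivity)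
  refine ⟨n0, fun n hn => ?_⟩
  have a1 := exprep hq hsq (hG n) hy hy1 x hN (hC n) hC0
  have a2 := exprep hq hsq (hG n0) hy hy1 x hN (hC n0) hC0
  have a3 := hn0 n hn
  rw [dist_eq_norm] at a3 ⊢
  have e : G n (x + y * I) - G n0 (x + y * I) = (G n (x + y * I) - ∫ t : ℝ, G n t * v t) +
      ((∫ t : ℝ, G n t * v t) - ∫ t : ℝ, G n0 t * v t) - (G n0 (x + y * I) - ∫ t : ℝ, G n0 t * v t) := by ring
  rw [e]
  calc _ ≤ _ + _ := norm_sub_le _ _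
    _ ≤ (_ + _) + _ := by gcongr; exact norm_add_le _ _
    _ < (δ / 3 + δ / 3) + δ / 3 := by
        gcongr
        · exact a1.trans_lt hNδ
        · exact a2.trans_lt hNδ
    _ = δ := by ring

lemma memLp_conj {u : ℝ → ℂ} {r : ℝ≥0∞} (hu : MemLp u r volume) : MemLp (fun x => (starRingEnd ℂ) (u x)) r volume :=
  hu.of_le (continuous_conj.comp_aestronglyMeasurable hu.1) (Eventually.of_forall fun x => (RCLike.norm_conj _).le)

lemma eLpNorm_conj_line (u : ℝ → ℂ) (r : ℝ≥0∞) : eLpNorm (fun x => (starRingEnd ℂ) (u x)) r volume = eLpNorm u r volume :=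
  eLpNorm_congr_norm_ae (Eventually.of_forall fun x => RCLike.norm_conj _)

lemma hn_le {p q : ℝ≥0∞} {h : ℂ → ℂ} {K : ℝ≥0∞} (H : ∀ y : ℝ, 0 < y → y < 1 → ∃ a b : ℝ → ℂ, Measurable a ∧ Measurable b ∧
    a + b = bLine h y ∧ ENNReal.ofReal (1 - y)⁻¹ * eLpNorm a p volume + ENNReal.ofReal y⁻¹ * eLpNorm b q volume ≤ K) :
    hardyNorm p q h ≤ K := by
  unfold hardyNorm
  refine iSup₂_le fun y hy => ?_
  obtain ⟨a, b, ha, hb, hab, hle⟩ := H y hy.1 hy.2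
  refine iInf_le_of_le a ?_
  refine iInf_le_of_le b ?_
  refine iInf_le_of_le ha ?_
  refine iInf_le_of_le hb ?_
  exact iInf_le_of_le hab hle

lemma ext_of_seq {p q pst qst : ℝ≥0∞} (hp : 1 ≤ p) (hq : 1 ≤ q) (hpc : p⁻¹ + pst⁻¹ = 1) (hqc : q⁻¹ + qst⁻¹ = 1)
    {G : ℕ → ℂ → ℂ} (hG : ∀ n, Nice (G n)) {A C : ℝ} (hA0 : 0 ≤ A) (hC0 : 0 ≤ C)
    (hA : ∀ n, eLpNorm (fun t : ℝ => G n t) pst volume ≤ ENNReal.ofReal A)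
    (hC : ∀ n, eLpNorm (fun t : ℝ => G n (t + I)) qst volume ≤ ENNReal.ofReal C) {g : ℝ → ℂ} (hg : MemLp g pst volume)
    (hw : ∀ v, MemLp v p volume → Tendsto (fun n => ∫ t : ℝ, G n t * v t) atTop (𝓝 (∫ t, g t * v t))) :
    ∃ m, MemHardy pst qst m ∧ IsTrace0 m g := by
  have hpc' : pst⁻¹ + p⁻¹ = 1 := by rwa [add_comm]
  have hqc' : qst⁻¹ + q⁻¹ = 1 := by rwa [add_comm]
  have hps : 1 ≤ pst := one_le_conj hpc
  have hqs : 1 ≤ qst := one_le_conj hqc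
  have hex : ∀ z : ℂ, ∃ l, z ∈ Strip → Tendsto (fun n => G n z) atTop (𝓝 l) := by
    intro z
    by_cases hz : z ∈ Strip
    · obtain ⟨l, hl⟩ := conv_pt hp hq hqc' hG hC0 hC hw hz.1 hz.2 z.re
      rw [re_add_im] at hl
      exact ⟨l, fun _ => hl⟩
    · exact ⟨0, fun h => absurd h hz⟩
  choose m hm using hex
  have hml : ∀ y : ℝ, 0 < y → y < 1 → ∀ x : ℝ, Tendsto (fun n => G n (x + y * I)) atTop (𝓝 (bLine m y x)) :=
    fun y h0 h1 x => hm _ (line_mem' h0 h1)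
  have hα : ∀ y : ℝ, 0 < y → ∀ x : ℝ, Tendsto (fun n => cv (kerA y) (fun t => G n t) 1 x) atTop (𝓝 (cv (kerA y) g 1 x)) := by
    intro y hy x
    simp_rw [cv_swap]
    exact hw _ (memLp_flip (kerA_memLp hy hp) x)
  have hhalf := fun y (h0 : 0 < y) (h1 : y < 1) => half hps hqs hG hA hC h0 h1 (hml y h0 h1) (hα y h0)
  refine ⟨m, ⟨?_, ?_⟩, ?_⟩
  · refine limit_diff (fun n => (hG n).diff) hm fun z0 hz0 => ?_
    obtain ⟨R, hR, hsub⟩ := Metric.isOpen_iff.mp isOpen_Strip z0 hz0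
    have hd : 0 < min z0.im (1 - z0.im) := lt_min hz0.1 (sub_pos.mpr hz0.2)
    set d := min z0.im (1 - z0.im) with hdd
    have d1 : d ≤ z0.im := min_le_left _ _
    have d2 : d ≤ 1 - z0.im := min_le_right _ _
    have him : ∀ z ∈ Metric.closedBall z0 (d / 2), d / 2 ≤ z.im ∧ d / 2 ≤ 1 - z.im := by
      intro z hz
      rw [Metric.mem_closedBall, dist_eq_norm] at hz
      have h1 := (Complex.abs_im_le_norm (z - z0)).trans hz
      rw [sub_im, abs_le] at h1
      constructor <;> linarith [h1.1, h1.2]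
    refine ⟨d / 2, by positivity, fun z hz => ⟨by linarith [(him z hz).1], by linarith [(him z hz).2]⟩,
      A * ((d / 2)⁻¹ * (eLpNorm dom p volume).toReal) + C * ((d / 2)⁻¹ * (eLpNorm dom q volume).toReal), fun n z hz => ?_⟩
    obtain ⟨i1, i2⟩ := him z hz
    have := nice_bound hp hq hpc' hqc' (hG n) hA0 hC0 (hA n) (hC n) (y := z.im) (by linarith) (by linarith) z.re
    rw [re_add_im] at this
    refine this.trans ?_
    gcongr
  · refine lt_of_le_of_lt (hn_le (K := ENNReal.ofReal (2 * (A + C))) fun y hy hy1 => ?_) ENNReal.ofReal_lt_top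
    have h1 : 0 < 1 - y := sub_pos.mpr hy1
    rcases le_total y (1 / 2) with hy2 | hy2
    · obtain ⟨m1, m2, n1, n2⟩ := hhalf y hy hy1
      refine ⟨_, _, m1, m2, add_sub_cancel _ _, ?_⟩
      calc _ ≤ ENNReal.ofReal (1 - y)⁻¹ * ENNReal.ofReal A + ENNReal.ofReal y⁻¹ * ENNReal.ofReal (y / (1 - y) * C) := by gcongr
        _ = ENNReal.ofReal ((1 - y)⁻¹ * (A + C)) := by
          rw [← ENNReal.ofReal_mul (by positivity), ← ENNReal.ofReal_mul (by positivity), ← ENNReal.ofReal_add (by positivity) (by positivity)]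
          congr 1
          field_simp
        _ ≤ _ := by
          refine ENNReal.ofReal_le_ofReal ?_
          have : (1 - y)⁻¹ ≤ 2 := by
            rw [inv_le_comm₀ h1 two_pos]; linarith
          gcongr
    · -- reflected picture
      set y' := 1 - y with hy'
      have h1' : y' < 1 := by linarith
      have hb' : ∀ x : ℝ, Tendsto (fun n => G n (I - (x + y' * I))) atTop (𝓝 (bLine m y (-x))) := by
        intro x
        have := hml y hy hy1 (-x)
        have e : (I : ℂ) - (x + y' * I) = ((-x : ℝ) : ℂ) + y * I := by rw [hy']; push_cast; ring
        rw [e]; exact this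
      have hκ : ∀ x : ℝ, MemLp (fun t => kerB y' (x + t)) p volume := fun x =>
        (kerB_memLp h1 h1' hp).comp_measurePreserving (measurePreserving_add_left volume x)
      have hc1 : ∀ x : ℝ, Tendsto (fun n => cv (kerB y') (fun t => G n (I - (t + I))) 1 x) atTop (𝓝 (∫ t, g t * kerB y' (x + t))) := by
        intro x
        refine (hw _ (hκ x)).congr fun n => ?_
        rw [cv_swap, ← integral_neg_eq_self]
        congr 1; funext t
        congr 2
        push_cast; ring
      have hα' : ∀ x : ℝ, Tendsto (fun n => cv (kerA y') (fun t => G n (I - t)) 1 x) atTop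
          (𝓝 (bLine m y (-x) - ∫ t, g t * kerB y' (x + t))) := by
        intro x
        refine ((hb' x).sub (hc1 x)).congr fun n => ?_
        have := rep (hG n).refl h1 h1' x
        rw [this, add_sub_cancel_right]
      have b1 : ∀ n, eLpNorm (fun t : ℝ => G n (I - t)) qst volume ≤ ENNReal.ofReal C := by
        intro n
        refine le_trans (le_of_eq ?_) (hC n)
        rw [← eLpNorm_flip (hG n).cont1.aestronglyMeasurable 0]
        congr 1; funext t
        congr 1; push_cast; ring
      have b2 : ∀ n, eLpNorm (fun t : ℝ => G n (I - (t + I))) pst volume ≤ ENNReal.ofReal A := by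
        intro n
        refine le_trans (le_of_eq ?_) (hA n)
        rw [← eLpNorm_flip (hG n).cont0.aestronglyMeasurable 0]
        congr 1; funext t
        congr 1; push_cast; ring
      obtain ⟨m1, m2, n1, n2⟩ := half hqs hps (fun n => (hG n).refl) b1 b2 h1 h1' hb' hα'
      set α : ℝ → ℂ := fun x => bLine m y (-x) - ∫ t, g t * kerB y' (x + t) with hαd
      refine ⟨fun x => ((fun x => bLine m y (-x)) - α) (0 - x), fun x => α (0 - x), m2.comp (by fun_prop), m1.comp (by fun_prop), ?_, ?_⟩
      · funext x
        simp
      · rw [eLpNorm_flip m2.aestronglyMeasurable, eLpNorm_flip m1.aestronglyMeasurable]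
        have hyy : 1 - y' = y := by rw [hy']; ring
        rw [hyy] at n2
        calc _ ≤ ENNReal.ofReal y'⁻¹ * ENNReal.ofReal (y' / y * A) + ENNReal.ofReal y⁻¹ * ENNReal.ofReal C := by gcongr
          _ = ENNReal.ofReal (y⁻¹ * (A + C)) := by
            rw [← ENNReal.ofReal_mul (by positivity), ← ENNReal.ofReal_mul (by positivity), ← ENNReal.ofReal_add (by positivity) (by positivity)]
            congr 1
            field_simp
          _ ≤ _ := by
            refine ENNReal.ofReal_le_ofReal ?_
            have : y⁻¹ ≤ 2 := by
              rw [inv_le_comm₀ hy two_pos]; linarith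
            gcongr
  · intro φ
    have hφp : MemLp (fun x => (starRingEnd ℂ) (φ x)) p volume := memLp_conj (φ.memLp p)
    have hφq : MemLp (fun x => (starRingEnd ℂ) (φ x)) q volume := memLp_conj (φ.memLp q)
    have t1 := (tendsto_moll hps hp hpc' (kerA_int one_pos) (kerA_integral one_pos) hg hφp).mono_left
      (nhdsWithin_le_nhds (s := Ioi 0))
    have t2 : Tendsto (fun y : ℝ => ∫ x, (bLine m y - cv (kerA y) g 1) x * (starRingEnd ℂ) (φ x)) (𝓝[>] 0) (𝓝 0) := by
      set D := (eLpNorm (fun x => (starRingEnd ℂ) (φ x)) q volume).toReal with hD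
      have h0 : Tendsto (fun y : ℝ => y / (1 - y) * C * D) (𝓝[>] 0) (𝓝 0) := by
        have : ContinuousAt (fun y : ℝ => y / (1 - y) * C * D) 0 := by
          refine ((continuousAt_id.div (by fun_prop) (by norm_num)).mul continuousAt_const).mul continuousAt_const
        have h := this.tendsto
        simp only [zero_div, zero_mul] at h
        exact h.mono_left nhdsWithin_le_nhds
      refine squeeze_zero_norm' ?_ h0
      filter_upwards [Ioo_mem_nhdsGT (zero_lt_one' ℝ)] with y hy
      have h1 : 0 < 1 - y := sub_pos.mpr hy.2
      obtain ⟨m1, m2, n1, n2⟩ := hhalf y hy.1 hy.2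
      refine (holder_norm hqc' ⟨m2.aestronglyMeasurable, n2.trans_lt ENNReal.ofReal_lt_top⟩ hφq).trans ?_
      have : 0 ≤ y / (1 - y) * C := mul_nonneg (div_nonneg hy.1.le h1.le) hC0
      gcongr
      exact ENNReal.toReal_le_of_le_ofReal this n2
    have t3 := t1.add t2
    rw [add_zero] at t3
    refine t3.congr' ?_
    filter_upwards [Ioo_mem_nhdsGT (zero_lt_one' ℝ)] with y hy
    obtain ⟨m1, m2, n1, n2⟩ := hhalf y hy.1 hy.2
    have e1 : cv (kerA 1) g y = cv (kerA y) g 1 := funext fun x => (cv_kerA_scale hy.1 g x).symm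
    rw [e1, ← integral_add]
    · refine integral_congr_ae (Eventually.of_forall fun x => ?_)
      simp only [Pi.sub_apply, bLine]
      ring
    · exact holder_integrable hpc' ⟨m1.aestronglyMeasurable, n1.trans_lt ENNReal.ofReal_lt_top⟩ hφp
    · exact holder_integrable hqc' ⟨m2.aestronglyMeasurable, n2.trans_lt ENNReal.ofReal_lt_top⟩ hφq

lemma exists_ext {p q pst qst : ℝ≥0∞} (hp : 1 ≤ p) (hq : 1 ≤ q) (hpc : p⁻¹ + pst⁻¹ = 1) (hqc : q⁻¹ + qst⁻¹ = 1)
    {g : ℝ → ℂ} (hg : MemLp g pst volume) {C : ℝ} (hC : 0 ≤ C)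
    (H : ∀ (h : ℂ → ℂ) (h0 h1 : ℝ → ℂ), MemHardy p q h →
        IsTrace0 h h0 → IsTrace1 h h1 → MemLp h0 p volume → MemLp h1 q volume →
        ‖∫ x : ℝ, g x * h0 x‖ ≤ C * (eLpNorm h1 q volume).toReal) :
    ∃ m, MemHardy pst qst m ∧ IsTrace0 m g := by
  have hpc' : pst⁻¹ + p⁻¹ = 1 := by rwa [add_comm]
  have hps : 1 ≤ pst := one_le_conj hpc
  have hε : ∀ n : ℕ, 0 < 1 / ((n : ℝ) + 1) := fun n => by positivity
  have hn : ∀ n : ℕ, Nice (E (1 / ((n : ℝ) + 1)) g) := by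
    intro n
    have := E_nice (hε n) hp hpc' hg le_rfl zero_le_one
    simpa only [ofReal_zero, zero_mul, sub_zero] using this
  have e0 : ∀ n : ℕ, (fun t : ℝ => E (1 / ((n : ℝ) + 1)) g t) = cv gk g (1 / ((n : ℝ) + 1)) := fun n =>
    funext fun t => E_real (hε n) g t
  refine ext_of_seq hp hq hpc hqc hn (A := (eLpNorm g pst volume).toReal) (C := C) ENNReal.toReal_nonneg hC ?_ ?_ hg ?_
  · intro n
    rw [e0, ENNReal.ofReal_toReal hg.2.ne]
    have := young (hε n).ne' hps gk_int hg.1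
    rwa [gk_lint, one_mul] at this
  · intro n
    refine dual_bound hqc (hn n).cont1.aestronglyMeasurable hC fun φ hφ => ?_
    obtain ⟨h, t1, t2, t3, t4, t5, t6⟩ := test_hardy hp hq (hε n) hφ
    rw [← E_adj (hε n) hpc (hφ.memLp p) hg]
    refine (H h _ _ t1 t2 t3 t4 t5).trans ?_
    gcongr
    exact (hφ.memLp q).2.ne
  · intro v hv
    have := (tendsto_moll hps hp hpc' gk_int gk_integral hg hv).comp (tendsto_one_div_add_atTop_nhds_zero_nat (𝕜 := ℝ))
    refine this.congr fun n => ?_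
    simp only [Function.comp]
    rw [← e0]

/-! ### Reflection -/

lemma reflect_reflect (m : ℂ → ℂ) : reflect (reflect m) = m := by
  funext z; simp [reflect]

lemma reflect_line (m : ℂ → ℂ) (x y : ℝ) : reflect m (x + y * I) = (starRingEnd ℂ) (m (x + ((-y : ℝ) : ℂ) * I)) := by
  simp [reflect]

def conjS (φ : SchwartzMap ℝ ℂ) : SchwartzMap ℝ ℂ := SchwartzMap.postcompCLM (𝕜 := ℝ) (conjCLE : ℂ →L[ℝ] ℂ) φ

lemma conjS_apply (φ : SchwartzMap ℝ ℂ) (x : ℝ) : conjS φ x = (starRingEnd ℂ) (φ x) := by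
  simp [conjS]

lemma int_reflect (m : ℂ → ℂ) (φ : SchwartzMap ℝ ℂ) (y : ℝ) :
    ∫ x : ℝ, reflect m (x + y * I) * (starRingEnd ℂ) (φ x) =
      (starRingEnd ℂ) (∫ x : ℝ, m (x + ((-y : ℝ) : ℂ) * I) * (starRingEnd ℂ) (conjS φ x)) := by
  rw [← integral_conj]
  congr 1; funext x
  rw [reflect_line, map_mul, conjS_apply, conj_conj]

lemma int_conj (v : ℝ → ℂ) (φ : SchwartzMap ℝ ℂ) :
    ∫ x : ℝ, (starRingEnd ℂ) (v x) * (starRingEnd ℂ) (φ x) =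
      (starRingEnd ℂ) (∫ x : ℝ, v x * (starRingEnd ℂ) (conjS φ x)) := by
  rw [← integral_conj]
  congr 1; funext x
  rw [map_mul, conjS_apply, conj_conj]

lemma trace_reflect {m : ℂ → ℂ} {v : ℝ → ℂ} {l l' : Filter ℝ} (hl : Tendsto (fun y : ℝ => -y) l l')
    (h : ∀ φ : SchwartzMap ℝ ℂ, Tendsto (fun y : ℝ => ∫ x : ℝ, m (x + y * I) * (starRingEnd ℂ) (φ x)) l'
      (𝓝 (∫ x : ℝ, v x * (starRingEnd ℂ) (φ x)))) (φ : SchwartzMap ℝ ℂ) :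
    Tendsto (fun y : ℝ => ∫ x : ℝ, reflect m (x + y * I) * (starRingEnd ℂ) (φ x)) l
      (𝓝 (∫ x : ℝ, (starRingEnd ℂ) (v x) * (starRingEnd ℂ) (φ x))) := by
  simp_rw [int_reflect, int_conj]
  exact (continuous_conj.tendsto _).comp ((h (conjS φ)).comp hl)

lemma trace0_reflect {F : ℂ → ℂ} {f : ℝ → ℂ} (h : IsTraceStar0 F f) : IsTrace0 (reflect F) (fun x => (starRingEnd ℂ) (f x)) :=
  fun φ => trace_reflect (by simpa using tendsto_neg_nhdsGT (a := (0:ℝ))) h φ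

lemma trace1_reflect {F : ℂ → ℂ} {f : ℝ → ℂ} (h : IsTraceStarNeg1 F f) : IsTrace1 (reflect F) (fun x => (starRingEnd ℂ) (f x)) :=
  fun φ => trace_reflect (by simpa using tendsto_neg_nhdsLT (a := (1:ℝ))) h φ

lemma traceStar0_reflect {m : ℂ → ℂ} {g : ℝ → ℂ} (h : IsTrace0 m g) : IsTraceStar0 (reflect m) (fun x => (starRingEnd ℂ) (g x)) :=
  fun φ => trace_reflect (by simpa using tendsto_neg_nhdsLT (a := (0:ℝ))) h φ

lemma norm_int_conj (f h0 : ℝ → ℂ) : ‖∫ x, f x * (starRingEnd ℂ) (h0 x)‖ = ‖∫ x, (starRingEnd ℂ) (f x) * h0 x‖ := by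
  rw [← RCLike.norm_conj, ← integral_conj]
  congr 2; funext x
  rw [map_mul, conj_conj]

/-- **Necessary and sufficient conditions for holomorphic extension** (Lemma 2.8). -/
theorem boundary_criteria (p q pst qst : ℝ≥0∞) (hp : 1 ≤ p) (hq : 1 ≤ q)
    (hpc : p⁻¹ + pst⁻¹ = 1) (hqc : q⁻¹ + qst⁻¹ = 1)
    (f : ℝ → ℂ) (hf : MemLp f pst volume) :
    ((∃ F : ℂ → ℂ, MemHardyStar pst qst F ∧ IsTraceStar0 F f) ↔
      ∃ C : ℝ, 0 < C ∧ ∀ (h : ℂ → ℂ) (h0 h1 : ℝ → ℂ), MemHardy p q h →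
        IsTrace0 h h0 → IsTrace1 h h1 → MemLp h0 p volume → MemLp h1 q volume →
        ‖∫ x : ℝ, f x * (starRingEnd ℂ) (h0 x)‖ ≤ C * (eLpNorm h1 q volume).toReal) ∧
    (∀ F F' : ℂ → ℂ, MemHardyStar pst qst F → IsTraceStar0 F f →
      MemHardyStar pst qst F' → IsTraceStar0 F' f → ∀ z ∈ StripStar, F z = F' z) ∧
    (∀ (F : ℂ → ℂ) (F1 : ℝ → ℂ), MemHardyStar pst qst F → IsTraceStar0 F f →
      IsTraceStarNeg1 F F1 → MemLp F1 qst volume →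
      (∀ (h : ℂ → ℂ) (h0 h1 : ℝ → ℂ), MemHardy p q h →
        IsTrace0 h h0 → IsTrace1 h h1 → MemLp h0 p volume → MemLp h1 q volume →
        ‖∫ x : ℝ, f x * (starRingEnd ℂ) (h0 x)‖ ≤
          (eLpNorm F1 qst volume).toReal * (eLpNorm h1 q volume).toReal) ∧
      ∀ C' : ℝ, (∀ (h : ℂ → ℂ) (h0 h1 : ℝ → ℂ), MemHardy p q h →
          IsTrace0 h h0 → IsTrace1 h h1 → MemLp h0 p volume → MemLp h1 q volume →
          ‖∫ x : ℝ, f x * (starRingEnd ℂ) (h0 x)‖ ≤ C' * (eLpNorm h1 q volume).toReal) →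
        (eLpNorm F1 qst volume).toReal ≤ C') := by
  have hfc := memLp_conj hf
  refine ⟨⟨?_, ?_⟩, ?_, ?_⟩
  · rintro ⟨F, hF, hF0⟩
    have hm : MemHardy pst qst (reflect F) := hF
    obtain ⟨M, hM, hd⟩ := hm.decomp
    refine ⟨M + 1, by positivity, fun h h0 h1 hh t0 t1 l0 l1 => ?_⟩
    rw [norm_int_conj]
    refine (pairing hp hq hpc hqc hm hh (trace0_reflect hF0) t0 t1 hfc l0 l1 hM hd).1.trans ?_
    gcongr
    linarith
  · rintro ⟨C, hC, H⟩
    obtain ⟨m, hm, hm0⟩ := exists_ext hp hq hpc hqc hfc hC.le (fun h h0 h1 hh t0 t1 l0 l1 => by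
      rw [← norm_int_conj]
      exact H h h0 h1 hh t0 t1 l0 l1)
    refine ⟨reflect m, ?_, ?_⟩
    · unfold MemHardyStar
      rwa [reflect_reflect]
    · have := traceStar0_reflect hm0
      simpa only [conj_conj] using this
  · intro F F' hF hF0 hF' hF0' z hz
    have hps : q⁻¹ + qst⁻¹ = 1 := hqc
    have hu := hardy_unique (p := pst) (q := qst) (pst := p) (qst := q) (one_le_conj hqc)
      (by rwa [add_comm]) (by rwa [add_comm]) hF hF' (trace0_reflect hF0) (trace0_reflect hF0')
      ((starRingEnd ℂ) z) ⟨by rw [conj_im]; linarith [hz.2], by rw [conj_im]; linarith [hz.1]⟩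
    simp only [reflect, conj_conj] at hu
    exact (starRingEnd ℂ).injective hu
  · intro F F1 hF hF0 hF1 l1
    have hm : MemHardy pst qst (reflect F) := hF
    refine ⟨fun h h0 h1 hh t0 t1 lh0 lh1 => ?_, fun C' H => ?_⟩
    · obtain ⟨M, hM, hd⟩ := hm.decomp
      have h2 := (pairing hp hq hpc hqc hm hh (trace0_reflect hF0) t0 t1 hfc lh0 lh1 hM hd).2 _
        (trace1_reflect hF1) (memLp_conj l1)
      rw [norm_int_conj, h2, ← eLpNorm_conj_line F1]
      exact holder_norm (by rwa [add_comm]) (memLp_conj l1) lh1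
    · rw [← eLpNorm_conj_line F1]
      refine optimal hp hq hpc hqc hm (trace0_reflect hF0) (trace1_reflect hF1) hfc (memLp_conj l1)
        (fun h h0 h1 hh t0 t1 lh0 lh1 => ?_)
      rw [← norm_int_conj]
      exact H h h0 h1 hh t0 t1 lh0 lh1
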